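/- arXiv:1807.00391 — 2 statements merged into one kernel-verified Lean document; each statement's English description precedes it below -/
import Mathlib

section
/- Let N ≥ 1, k ≥ 1, let f be a modular form of weight k on Γ₀(N) (i.e. on Γ₁(N) with trivial Nebentypus: f|_k γ = f for all γ ∈ Γ₀(N)), and let g = (A, B; C, D) ∈ SL₂(ℤ). Set N' = N/gcd(CD, N). Then every Fourier coefficient of f |_k g (in its expansion Σ_{n≥0} c_n e^{2πinτ/N}) lies in the subfield K_f(ζ_{N'}) of ℂ generated by K_f and ζ_{N'}. -/
open Complex UpperHalfPlane CongruenceSubgroup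
open scoped ModularForm MatrixGroups Real

noncomputable section

/-- `ζ_N = e^{2πi/N}`. -/
def zetaC (N : ℕ) : ℂ := Complex.exp (2 * Real.pi * Complex.I / N)

/-- `f` has the Fourier expansion `Σ_{n ≥ 0} c n · e^{2πinτ/N}`. -/
def HasExpansion (N : ℕ) (f : ℍ → ℂ) (c : ℕ → ℂ) : Prop :=
  ∀ τ : ℍ, HasSum (fun n : ℕ => c n * Complex.exp (2 * Real.pi * Complex.I * n * (τ : ℂ) / N)) (f τ)


namespace S6

open Function PowerSeries

/-- `F` has `q_N`-expansion `p`. -/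
def HE (N : ℕ) (F : ℍ → ℂ) (p : PowerSeries ℂ) : Prop :=
  ∀ τ : ℍ, HasSum (fun n : ℕ => coeff n p * Periodic.qParam (N : ℝ) (τ : ℂ) ^ n) (F τ)

lemma qParam_pow (N n : ℕ) (z : ℂ) :
    Periodic.qParam (N : ℝ) z ^ n = Complex.exp (2 * Real.pi * Complex.I * n * z / N) := by
  rw [Periodic.qParam, ← Complex.exp_nat_mul]
  congr 1
  push_cast
  ring

lemma HE_of_hasExpansion {N : ℕ} {F : ℍ → ℂ} {c : ℕ → ℂ} (h : HasExpansion N F c) :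
    HE N F (PowerSeries.mk c) := by
  intro τ
  simpa only [coeff_mk, qParam_pow] using h τ

namespace HE

variable {N : ℕ} {F G : ℍ → ℂ} {p r : PowerSeries ℂ}

lemma add (hF : HE N F p) (hG : HE N G r) : HE N (F + G) (p + r) := by
  intro τ
  simpa [add_mul] using (hF τ).add (hG τ)

lemma sub (hF : HE N F p) (hG : HE N G r) : HE N (F - G) (p - r) := by
  intro τ
  simpa [sub_mul] using (hF τ).sub (hG τ)

lemma smul (c : ℂ) (hF : HE N F p) : HE N (c • F) (c • p) := by
  intro τ
  simpa [mul_assoc] using (hF τ).mul_left c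

lemma zero : HE N 0 0 := by
  intro τ
  simp

lemma one : HE N 1 1 := by
  intro τ
  have := hasSum_single (f := fun n : ℕ => coeff n (1 : PowerSeries ℂ) *
    Periodic.qParam (N : ℝ) (τ : ℂ) ^ n) 0 (by
      intro b hb
      simp [coeff_one, hb])
  simpa using this

lemma mul (hF : HE N F p) (hG : HE N G r) : HE N (F * G) (p * r) := by
  intro τ
  have h1 := (hF τ).summable.norm
  have h2 := (hG τ).summable.norm
  have h3 := (summable_norm_sum_mul_antidiagonal_of_summable_norm h1 h2).of_norm
  have h4 := tsum_mul_tsum_eq_tsum_sum_antidiagonal_of_summable_norm h1 h2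
  rw [(hF τ).tsum_eq, (hG τ).tsum_eq] at h4
  have h5 := h3.hasSum
  rw [← h4] at h5
  have h6 : (fun n : ℕ => coeff n (p * r) * Periodic.qParam (N : ℝ) (τ : ℂ) ^ n) = fun n : ℕ =>
      ∑ kl ∈ Finset.HasAntidiagonal.antidiagonal n, coeff kl.1 p * Periodic.qParam (N : ℝ) (τ : ℂ) ^ kl.1 *
        (coeff kl.2 r * Periodic.qParam (N : ℝ) (τ : ℂ) ^ kl.2) := ?_
  · rw [h6]; exact h5
  funext n
  rw [coeff_mul, Finset.sum_mul]
  refine Finset.sum_congr rfl fun x hx => ?_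
  rw [← Finset.HasAntidiagonal.mem_antidiagonal.mp hx, pow_add]
  ring

lemma pow (hF : HE N F p) (n : ℕ) : HE N (F ^ n) (p ^ n) := by
  induction n with
  | zero => simpa using one
  | succ n ih => simpa [pow_succ] using ih.mul hF

lemma sum {ι : Type*} {s : Finset ι} {F : ι → ℍ → ℂ} {p : ι → PowerSeries ℂ}
    (h : ∀ i ∈ s, HE N (F i) (p i)) : HE N (∑ i ∈ s, F i) (∑ i ∈ s, p i) := by
  classical
  induction s using Finset.induction_on with
  | empty => simpa using zero
  | insert a s ha ih =>
    rw [Finset.sum_insert ha, Finset.sum_insert ha]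
    exact (h a (by simp)).add (ih fun i hi => h i (by simp [hi]))

lemma prod {ι : Type*} {s : Finset ι} {F : ι → ℍ → ℂ} {p : ι → PowerSeries ℂ}
    (h : ∀ i ∈ s, HE N (F i) (p i)) : HE N (∏ i ∈ s, F i) (∏ i ∈ s, p i) := by
  classical
  induction s using Finset.induction_on with
  | empty => simpa using one
  | insert a s ha ih =>
    rw [Finset.prod_insert ha, Finset.prod_insert ha]
    exact (h a (by simp)).mul (ih fun i hi => h i (by simp [hi]))

lemma ext (hF : HE N F p) (hG : HE N G p) : F = G := by
  funext τ
  exact (hF τ).unique (hG τ)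

lemma analytic_zero (hN : (0 : ℝ) < N) :
    AnalyticAt ℂ (UpperHalfPlane.cuspFunction (N : ℝ) (fun _ : ℍ => (0 : ℂ))) 0 := by
  refine UpperHalfPlane.analyticAt_cuspFunction_zero hN ?_ ?_ ?_
  · intro x; rfl
  · exact mdifferentiable_const
  · exact Filter.const_boundedAtFilter _ _

lemma eq_zero (hN : 1 ≤ N) (h : HE N (fun _ => 0) p) : p = 0 := by
  refine PowerSeries.ext fun m => ?_
  have hN' : (0 : ℝ) < N := Nat.cast_pos.mpr hN
  have han := analytic_zero hN'
  have h1 := (UpperHalfPlane.hasFPowerSeriesOnBall_cuspFunction (c := fun m => coeff m p) hN' han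
    h).hasFPowerSeriesAt
  have h2 := (UpperHalfPlane.hasFPowerSeriesOnBall_cuspFunction (c := fun _ => (0 : ℂ)) hN' han
    (fun τ => by simpa using hasSum_zero)).hasFPowerSeriesAt
  simpa using congr_arg (FormalMultilinearSeries.coeff · m) (h1.eq_formalMultilinearSeries h2)

lemma unique (hN : 1 ≤ N) (hF : HE N F p) (hF' : HE N F r) : p = r := by
  have := hF.sub hF'
  rw [sub_self, show (0 : ℍ → ℂ) = fun _ => 0 from rfl] at this
  exact sub_eq_zero.mp (this.eq_zero hN)

lemma ne_zero (hF : HE N F p) (h : F ≠ 0) : p ≠ 0 := by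
  rintro rfl
  exact h (hF.ext zero)

lemma bdd (hN : 1 ≤ N) (hF : HE N F p) : IsBoundedAtImInfty F := by
  have hN' : (0 : ℝ) < N := by exact_mod_cast hN
  exact isBoundedAtImInfty_of_hasSum_qExpansion (c := fun m => coeff m p) hN'
    (fun τ => by simpa only [smul_eq_mul] using hF τ)

end HE

/-- Reindexing of an expansion. -/
lemma HE_extend {N t : ℕ} (ht : 0 < t) {F : ℍ → ℂ} {c : ℕ → ℂ}
    (h : ∀ τ : ℍ, HasSum (fun n : ℕ => c n * Periodic.qParam (N : ℝ) (τ : ℂ) ^ (n * t)) (F τ)) :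
    HE N F (PowerSeries.mk (Function.extend (fun n => n * t) c 0)) := by
  intro τ
  have hinj : Function.Injective (fun n : ℕ => n * t) := fun a b hab =>
    Nat.eq_of_mul_eq_mul_right ht hab
  have := h τ
  rw [← hinj.hasSum_iff (f := fun n => coeff n (PowerSeries.mk (Function.extend (fun n => n * t) c 0))
    * Periodic.qParam (N : ℝ) (τ : ℂ) ^ n)]
  · convert this using 2 with n
    simp [hinj.extend_apply]
  · intro x hx
    rw [coeff_mk, Function.extend_apply' _ _ _ (by simpa using hx)]
    simp

lemma extend_mem {S : Subfield ℂ} {t : ℕ} (ht : 0 < t) {c : ℕ → ℂ} (hc : ∀ n, c n ∈ S) (m : ℕ) :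
    Function.extend (fun n => n * t) c 0 m ∈ S := by
  have hinj : Function.Injective (fun n : ℕ => n * t) := fun a b hab =>
    Nat.eq_of_mul_eq_mul_right ht hab
  by_cases hm : ∃ n, n * t = m
  · obtain ⟨n, rfl⟩ := hm
    rw [hinj.extend_apply (g := c) (e' := 0) n]
    exact hc n
  · rw [Function.extend_apply' _ _ _ hm]
    exact S.zero_mem

lemma qParam_one_eq {N : ℕ} (hN : 1 ≤ N) (z : ℂ) :
    Periodic.qParam (1 : ℝ) z = Periodic.qParam (N : ℝ) z ^ N := by
  have : (N : ℂ) ≠ 0 := by exact_mod_cast (by omega : N ≠ 0)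
  rw [qParam_pow, Periodic.qParam]
  congr 1
  push_cast
  field_simp

lemma HE_stretch {N : ℕ} (hN : 1 ≤ N) {F : ℍ → ℂ} {c : ℕ → ℂ}
    (h : ∀ τ : ℍ, HasSum (fun n : ℕ => c n * Periodic.qParam (1 : ℝ) (τ : ℂ) ^ n) (F τ)) :
    HE N F (PowerSeries.mk (Function.extend (fun n => n * N) c 0)) := by
  refine HE_extend (by omega) fun τ => ?_
  convert h τ using 3 with n
  rw [qParam_one_eq hN, ← pow_mul, mul_comm]

/-- power series with coefficients in a subfield -/
def coeffsIn (S : Subfield ℂ) : Subring (PowerSeries ℂ) :=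
  (PowerSeries.map S.subtype).range

lemma mem_coeffsIn {S : Subfield ℂ} {p : PowerSeries ℂ} :
    p ∈ coeffsIn S ↔ ∀ n, coeff n p ∈ S := by
  constructor
  · rintro ⟨r, rfl⟩ n
    simp
  · intro h
    refine ⟨PowerSeries.mk fun n => ⟨coeff n p, h n⟩, ?_⟩
    ext n
    simp

lemma coeffsIn_of_mul {S : Subfield ℂ} {u v : PowerSeries ℂ} (hv : v ∈ coeffsIn S) (hv0 : v ≠ 0)
    (huv : u * v ∈ coeffsIn S) : u ∈ coeffsIn S := by
  obtain ⟨v', rfl⟩ := hv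
  obtain ⟨w', hw⟩ := huv
  have hv0' : v' ≠ 0 := by
    rintro rfl
    simp at hv0
  have hd : constantCoeff v'.divXPowOrder ≠ 0 := by
    rw [constantCoeff_divXPowOrder]
    exact PowerSeries.coeff_order hv0'
  have hinv := PowerSeries.mul_inv_cancel _ hd
  have hfac := X_pow_order_mul_divXPowOrder (f := v')
  set m := v'.order.toNat
  have key : u * X ^ m = PowerSeries.map S.subtype (w' * v'.divXPowOrder⁻¹) := by
    have e1 : PowerSeries.map S.subtype v' = X ^ m * PowerSeries.map S.subtype v'.divXPowOrder := by
      conv_lhs => rw [← hfac]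
      simp
    rw [map_mul, hw, e1, mul_assoc, mul_assoc, ← map_mul, hinv]
    simp
  rw [mem_coeffsIn]
  intro n
  rw [← coeff_mul_X_pow u m n, key, coeff_map]
  exact Subtype.property _

end S6

namespace S6

open EisensteinSeries ModularForm

/-- level-one monomials in `E₄`, `E₆`. -/
def LOne (w : ℤ) : Submodule ℂ (ℍ → ℂ) :=
  Submodule.span ℂ {F | ∃ a b : ℕ, (4 * a + 6 * b : ℤ) = w ∧ F = (⇑E₄ : ℍ → ℂ) ^ a * (⇑E₆ : ℍ → ℂ) ^ b}

lemma LOne_mul_mon {w : ℤ} {F : ℍ → ℂ} (hF : F ∈ LOne w) (a b : ℕ) {w' : ℤ}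
    (h : w' = w + 4 * a + 6 * b) : F * ((⇑E₄ : ℍ → ℂ) ^ a * (⇑E₆ : ℍ → ℂ) ^ b) ∈ LOne w' := by
  induction hF using Submodule.span_induction with
  | mem x hx =>
    obtain ⟨a', b', h', rfl⟩ := hx
    refine Submodule.subset_span ⟨a' + a, b' + b, by push_cast; linarith, by ring⟩
  | zero => simp
  | add x y _ _ hx hy => rw [add_mul]; exact add_mem hx hy
  | smul c x _ hx => rw [smul_mul_assoc]; exact Submodule.smul_mem _ _ hx

lemma disc_eq : (ModularForm.discriminant : ℍ → ℂ) =
    (1 / 1728 : ℂ) • ((⇑E₄ : ℍ → ℂ) ^ 3 - (⇑E₆ : ℍ → ℂ) ^ 2) := by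
  funext z
  rw [discriminant_eq_E₄_cube_sub_E₆_sq z]
  simp only [Pi.smul_apply, Pi.sub_apply, Pi.pow_apply, smul_eq_mul]
  ring

lemma exists_mon (n : ℕ) (hn : 4 ≤ n) (he : Even n) : ∃ a b : ℕ, 4 * a + 6 * b = n := by
  obtain ⟨m, rfl⟩ := he
  rcases Nat.even_or_odd m with ⟨l, rfl⟩ | ⟨l, rfl⟩
  · exact ⟨l, 0, by omega⟩
  · exact ⟨l - 1, 1, by omega⟩

/-- the monomial as a modular form -/
def monForm (a b : ℕ) {w : ℤ} (h : (4 * a + 6 * b : ℤ) = w) : ModularForm 𝒮ℒ w :=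
  ModularForm.mcast (by push_cast; linarith) ((E₄.pow a).mul (E₆.pow b))

lemma monForm_coe (a b : ℕ) {w : ℤ} (h : (4 * a + 6 * b : ℤ) = w) :
    (⇑(monForm a b h) : ℍ → ℂ) = (⇑E₄ : ℍ → ℂ) ^ a * (⇑E₆ : ℍ → ℂ) ^ b := by
  simp [monForm]

lemma monForm_coeff (a b : ℕ) {w : ℤ} (h : (4 * a + 6 * b : ℤ) = w) :
    (qExpansion 1 (monForm a b h)).coeff 0 = 1 := by
  have h1 : qExpansion 1 (monForm a b h) = qExpansion 1 E₄ ^ a * qExpansion 1 E₆ ^ b := by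
    rw [← ModularForm.qExpansion_pow one_pos one_mem_strictPeriods_SL,
      ← ModularForm.qExpansion_pow one_pos one_mem_strictPeriods_SL,
      ← ModularForm.qExpansion_mul one_pos one_mem_strictPeriods_SL]
    rfl
  have h4 := E_qExpansion_coeff_zero (k := 4) (by norm_num) ⟨2, rfl⟩
  have h6 := E_qExpansion_coeff_zero (k := 6) (by norm_num) ⟨3, rfl⟩
  rw [PowerSeries.coeff_zero_eq_constantCoeff] at h4 h6
  rw [h1, PowerSeries.coeff_zero_eq_constantCoeff, map_mul, map_pow, map_pow]
  erw [h4, h6]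
  simp

theorem levelOne_mem (n : ℕ) : ∀ (w : ℤ) (F : ModularForm 𝒮ℒ w), w.toNat = n → (⇑F : ℍ → ℂ) ∈ LOne w := by
  induction n using Nat.strong_induction_on with | _ n ih =>
  intro w F hw
  by_cases hneg : w < 0
  · have : F = 0 := rank_zero_iff_forall_zero.mp (levelOne_neg_weight_rank_zero hneg) F
    rw [this]; exact zero_mem _
  rcases Int.even_or_odd w with he | ho
  swap
  · rw [levelOne_odd_weight_eq_zero ho F]; exact zero_mem _
  lift w to ℕ using (not_lt.mp hneg)
  obtain rfl : w = n := by simpa using hw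
  by_cases h0 : w = 0
  · subst h0
    obtain ⟨c, hc⟩ := ModularFormClass.levelOne_weight_zero_const (F := ModularForm 𝒮ℒ 0) F
    have : (⇑F : ℍ → ℂ) = c • ((⇑E₄ : ℍ → ℂ) ^ 0 * (⇑E₆ : ℍ → ℂ) ^ 0) := by
      erw [hc]; funext z; simp
    rw [this]
    exact Submodule.smul_mem _ _ (Submodule.subset_span ⟨0, 0, by simp, rfl⟩)
  by_cases h2 : w = 2
  · subst h2
    have : F = 0 := rank_zero_iff_forall_zero.mp levelOne_weight_two_rank_zero F
    rw [this]; exact zero_mem _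
  have he' : Even w := by exact_mod_cast he
  have h4 : 4 ≤ w := by obtain ⟨m, rfl⟩ := he'; omega
  obtain ⟨a, b, hab⟩ := exists_mon w h4 he'
  have hab' : (4 * a + 6 * b : ℤ) = (w : ℤ) := by exact_mod_cast hab
  set m := monForm a b hab' with hm
  set c := (qExpansion 1 F).coeff 0 with hc
  have hG : (qExpansion 1 ⇑(F - c • m)).coeff 0 = 0 := by
    rw [FunLike.coe_sub,
      ModularForm.qExpansion_sub one_pos one_mem_strictPeriods_SL, FunLike.coe_smul,
      ModularForm.qExpansion_smul one_pos one_mem_strictPeriods_SL, map_sub, PowerSeries.coeff_smul,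
      monForm_coeff, ← hc]
    simp
  have hD := discriminant_mul_discriminantEquiv (toCuspForm (F - c • m) hG)
  set H := CuspForm.discriminantEquiv (toCuspForm (F - c • m) hG) with hH
  have hHm : (⇑H : ℍ → ℂ) ∈ LOne ((w : ℤ) - 12) := ih _ (by omega) _ H rfl
  have hF : (⇑F : ℍ → ℂ) = (1 / 1728 : ℂ) • (⇑H * ((⇑E₄ : ℍ → ℂ) ^ 3 * (⇑E₆ : ℍ → ℂ) ^ 0) -
      ⇑H * ((⇑E₄ : ℍ → ℂ) ^ 0 * (⇑E₆ : ℍ → ℂ) ^ 2)) + c • ((⇑E₄ : ℍ → ℂ) ^ a * (⇑E₆ : ℍ → ℂ) ^ b) := by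
    have e1 : (⇑F : ℍ → ℂ) = ⇑(toCuspForm (F - c • m) hG) + c • (⇑m : ℍ → ℂ) := by
      funext z
      change F z = (F - c • m) z + c * m z
      rw [show (F - c • m) z = F z - c * m z from rfl]
      ring
    rw [e1, ← hD, disc_eq, hm, monForm_coe]
    funext z
    simp
    ring
  rw [hF]
  refine add_mem (Submodule.smul_mem _ _ (sub_mem (LOne_mul_mon hHm _ _ ?_) (LOne_mul_mon hHm _ _ ?_)))
    (Submodule.smul_mem _ _ (Submodule.subset_span ⟨a, b, hab', rfl⟩))
  · push_cast; ring
  · push_cast; ring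

end S6

namespace S6

open EisensteinSeries ModularForm

lemma E4_coeff_mem (S : Subfield ℂ) (n : ℕ) : (qExpansion 1 E₄).coeff n ∈ S := by
  rw [show (qExpansion 1 E₄).coeff n = _ from E_qExpansion_coeff (k := 4) (by norm_num) ⟨2, rfl⟩ n]
  split_ifs
  · exact S.one_mem
  · refine S.mul_mem (S.neg_mem (S.div_mem (S.mul_mem ?_ (natCast_mem S _)) (SubfieldClass.ratCast_mem S _))) (natCast_mem S _)
    exact ofNat_mem S 2

lemma E6_coeff_mem (S : Subfield ℂ) (n : ℕ) : (qExpansion 1 E₆).coeff n ∈ S := by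
  rw [show (qExpansion 1 E₆).coeff n = _ from E_qExpansion_coeff (k := 6) (by norm_num) ⟨3, rfl⟩ n]
  split_ifs
  · exact S.one_mem
  · refine S.mul_mem (S.neg_mem (S.div_mem (S.mul_mem ?_ (natCast_mem S _)) (SubfieldClass.ratCast_mem S _))) (natCast_mem S _)
    exact ofNat_mem S 2

lemma E4_hasSum (τ : ℍ) : HasSum (fun n : ℕ => (qExpansion 1 E₄).coeff n *
    Function.Periodic.qParam (1 : ℝ) (τ : ℂ) ^ n) (E₄ τ) :=
  ModularForm.hasSum_qExpansion E₄ one_pos one_mem_strictPeriods_SL τ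

lemma E6_hasSum (τ : ℍ) : HasSum (fun n : ℕ => (qExpansion 1 E₆).coeff n *
    Function.Periodic.qParam (1 : ℝ) (τ : ℂ) ^ n) (E₆ τ) :=
  ModularForm.hasSum_qExpansion E₆ one_pos one_mem_strictPeriods_SL τ

lemma E4_HE {N : ℕ} (hN : 1 ≤ N) (S : Subfield ℂ) : ∃ p, HE N (⇑E₄) p ∧ p ∈ coeffsIn S :=
  ⟨_, HE_stretch hN E4_hasSum, mem_coeffsIn.mpr fun n => by
    rw [PowerSeries.coeff_mk]; exact extend_mem (by omega) (E4_coeff_mem S) n⟩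

lemma E6_HE {N : ℕ} (hN : 1 ≤ N) (S : Subfield ℂ) : ∃ p, HE N (⇑E₆) p ∧ p ∈ coeffsIn S :=
  ⟨_, HE_stretch hN E6_hasSum, mem_coeffsIn.mpr fun n => by
    rw [PowerSeries.coeff_mk]; exact extend_mem (by omega) (E6_coeff_mem S) n⟩

/-- upper triangular matrix -/
def T (a b d : ℤ) (h : a * d ≠ 0) : GL (Fin 2) ℝ :=
  Matrix.GeneralLinearGroup.mkOfDetNeZero !![(a : ℝ), (b : ℝ); 0, (d : ℝ)] (by
    rw [Matrix.det_fin_two_of]; simp only [mul_zero, sub_zero]; exact_mod_cast h)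

lemma T_coe (a b d : ℤ) (h : a * d ≠ 0) :
    ((T a b d h : GL (Fin 2) ℝ) : Matrix (Fin 2) (Fin 2) ℝ) = !![(a : ℝ), (b : ℝ); 0, (d : ℝ)] := rfl

lemma T_det (a b d : ℤ) (h : a * d ≠ 0) : (T a b d h).det.val = (a : ℝ) * d := by
  rw [Matrix.GeneralLinearGroup.val_det_apply, T_coe, Matrix.det_fin_two_of]; ring

lemma T_slash {a b d : ℤ} (ha : 0 < a) (hd : 0 < d) (h : a * d ≠ 0) (τ : ℍ) :
    ((⇑E₄ : ℍ → ℂ) ∣[(4 : ℤ)] (T a b d h)) τ =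
      ((a : ℂ) * d) ^ 3 * ((d : ℂ) ^ 4)⁻¹ * E₄ (T a b d h • τ) ∧
    ((T a b d h • τ : ℍ) : ℂ) = (a * τ + b) / d := by
  have hpos : (0 : ℝ) < (T a b d h).det.val := by
    rw [T_det]; exact_mod_cast mul_pos ha hd
  have hden : denom (T a b d h) τ = d := by
    simp [denom, T_coe]
  refine ⟨?_, ?_⟩
  · rw [ModularForm.slash_apply, hden, T_det]
    have hab : |(a : ℝ) * d| = a * d := abs_of_pos (by exact_mod_cast mul_pos ha hd)
    rw [hab, UpperHalfPlane.σ, if_pos hpos]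
    have : ((4 : ℤ) - 1) = ((3 : ℕ) : ℤ) := by norm_num
    rw [this, zpow_natCast, show (-4 : ℤ) = -((4 : ℕ) : ℤ) by norm_num, zpow_neg, zpow_natCast]
    simp
    ring
  · rw [coe_smul_of_det_pos hpos, hden]
    simp [num, T_coe]

/-- `φ(τ) = N³ E₄(Nτ)` -/
def phi (N : ℕ) : ℍ → ℂ :=
  if h : (N : ℤ) * 1 ≠ 0 then (⇑E₄ : ℍ → ℂ) ∣[(4 : ℤ)] (T N 0 1 h) else 0

lemma mapGL_mat (g : SL(2, ℤ)) :
    ((Matrix.SpecialLinearGroup.mapGL ℝ g : GL (Fin 2) ℝ) : Matrix (Fin 2) (Fin 2) ℝ) =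
        !![((g 0 0 : ℤ) : ℝ), ((g 0 1 : ℤ) : ℝ); ((g 1 0 : ℤ) : ℝ), ((g 1 1 : ℤ) : ℝ)] := by
  ext i j; fin_cases i <;> fin_cases j <;> simp

/-- the combinatorial decomposition -/
lemma decomp (N : ℕ) (hN : 1 ≤ N) (g : SL(2, ℤ)) :
    ∃ (a b d : ℤ) (h : a * d ≠ 0) (h' : (N : ℤ) * 1 ≠ 0) (γ : SL(2, ℤ)), 0 < a ∧ 0 < d ∧ (N : ℤ) = a * d ∧
      a ∣ g 1 0 ∧ (d = 1 ↔ (N : ℤ) ∣ g 1 0) ∧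
      d ∣ (N / Int.gcd (g 1 0 * g 1 1) N : ℕ) * b ∧
      T N 0 1 h' * Matrix.SpecialLinearGroup.mapGL ℝ g = Matrix.SpecialLinearGroup.mapGL ℝ γ * T a b d h := by
  have hN0 : (N : ℤ) ≠ 0 := by exact_mod_cast (by omega : N ≠ 0)
  have hdet := g.det_coe
  rw [Matrix.det_fin_two] at hdet
  set A := g 0 0 with hA
  set B := g 0 1 with hB
  set C := g 1 0 with hC
  set D := g 1 1 with hD
  obtain ⟨d, hd⟩ := Int.gcd_dvd_left (N : ℤ) C
  obtain ⟨c', hc'⟩ := Int.gcd_dvd_right (N : ℤ) C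
  have hbez := Int.gcd_eq_gcd_ab (N : ℤ) C
  set a : ℤ := (Int.gcd (N : ℤ) C : ℤ) with ha
  have ha0 : 0 < a := by
    rw [ha]; exact_mod_cast Int.gcd_pos_of_ne_zero_left _ hN0
  have hd0 : 0 < d := by
    have : 0 < a * d := by rw [← hd]; exact_mod_cast hN
    exact pos_of_mul_pos_right this ha0.le
  have hcop : IsCoprime d c' := by
    refine ⟨Int.gcdA N C, Int.gcdB N C, ?_⟩
    apply mul_left_cancel₀ ha0.ne'
    linear_combination hd * (-(Int.gcdA (N:ℤ) C)) - (Int.gcdB (N:ℤ) C) * hc' - hbez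
  have hcop2 : IsCoprime A c' := by
    refine ⟨D, -(B * a), ?_⟩
    linear_combination hdet + B * hc'
  obtain ⟨u, v, huv⟩ := hcop.mul_left hcop2
  let γ : SL(2, ℤ) := ⟨!![d * A, -v; c', u], by rw [Matrix.det_fin_two_of]; linear_combination huv⟩
  refine ⟨a, u * N * B + v * D, d, (mul_pos ha0 hd0).ne', by simpa using hN0, γ, ha0, hd0, hd, ⟨c', hc'⟩, ?_, ?_, ?_⟩
  · constructor
    · intro h; rw [hd, h, mul_one]; exact ⟨c', hc'⟩
    · rintro ⟨e, he⟩
      have h1 : a * c' = a * (d * e) := by rw [← hc', he, hd]; ring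
      have h2 := mul_left_cancel₀ ha0.ne' h1
      have h3 : IsUnit d := by
        have : IsCoprime d (d * e) := h2 ▸ hcop
        exact isUnit_of_dvd_one (by
          obtain ⟨x, y, hxy⟩ := this
          exact ⟨x + y * e, by linear_combination -hxy⟩)
      rcases Int.isUnit_iff.mp h3 with h | h
      · exact h
      · omega
  · set G : ℕ := Int.gcd (C * D) N with hG
    have hGN : G ∣ N := by
      have := Int.gcd_dvd_right (C * D) (N : ℤ)
      exact_mod_cast this
    have hGN' : (N : ℤ) = G * (N / G : ℕ) := by
      exact_mod_cast (Nat.mul_div_cancel' hGN).symm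
    set N' : ℤ := ((N / G : ℕ) : ℤ) with hN'
    have hGa : (G : ℤ) ∣ a * D := by
      rw [hbez, add_mul]
      have h1 : (G : ℤ) ∣ N := by exact_mod_cast hGN
      have h2 : (G : ℤ) ∣ C * D := Int.gcd_dvd_left _ _
      refine dvd_add ?_ ?_
      · exact (h1.mul_right _).mul_right _
      · rw [mul_right_comm]; exact h2.mul_right _
    obtain ⟨e, he⟩ := hGa
    refine ⟨N' * u * a * B + v * e, ?_⟩
    apply mul_left_cancel₀ ha0.ne'
    linear_combination N' * v * he - hGN' * v * e + v * e * hd + N' * a * u * B * hd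
  · apply Matrix.GeneralLinearGroup.ext
    have hdR : (N : ℝ) = a * d := by exact_mod_cast hd
    have hcR : (C : ℝ) = a * c' := by exact_mod_cast hc'
    have hdetR : (A : ℝ) * D - B * C = 1 := by exact_mod_cast hdet
    have huvR : (u : ℝ) * (d * A) + v * c' = 1 := by exact_mod_cast huv
    intro i j
    have hgm : ((Matrix.SpecialLinearGroup.mapGL ℝ g : GL (Fin 2) ℝ) : Matrix (Fin 2) (Fin 2) ℝ) =
        !![(A : ℝ), (B : ℝ); (C : ℝ), (D : ℝ)] := by
      ext i j; fin_cases i <;> fin_cases j <;> simp [hA, hB, hC, hD]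
    have hγm : ((Matrix.SpecialLinearGroup.mapGL ℝ γ : GL (Fin 2) ℝ) : Matrix (Fin 2) (Fin 2) ℝ) =
        !![(d * A : ℝ), (-v : ℝ); (c' : ℝ), (u : ℝ)] := by
      rw [mapGL_mat]
      ext i j; fin_cases i <;> fin_cases j <;> simp [γ]
    rw [Units.val_mul, Units.val_mul, hgm, hγm, T_coe, T_coe, Matrix.mul_fin_two, Matrix.mul_fin_two]
    fin_cases i <;> fin_cases j <;> simp
    · rw [hdR]; ring
    · rw [hdR]
      linear_combination (-a * d * B) * huvR - v * d * hdetR - v * d * B * hcR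
    · rw [hcR]; ring
    · rw [hdR]
      linear_combination (-D) * huvR + d * u * hdetR + d * u * B * hcR

lemma E4_inv (γ : SL(2, ℤ)) : (⇑E₄ : ℍ → ℂ) ∣[(4 : ℤ)] γ = ⇑E₄ :=
  E₄.slash_action_eq' _ ⟨γ, rfl⟩

lemma E6_inv (γ : SL(2, ℤ)) : (⇑E₆ : ℍ → ℂ) ∣[(6 : ℤ)] γ = ⇑E₆ :=
  E₆.slash_action_eq' _ ⟨γ, rfl⟩

lemma hasSum_congr_fun {u v : ℕ → ℂ} {x : ℂ} (h : HasSum v x) (e : ∀ n, u n = v n) : HasSum u x := by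
  rw [show u = v from funext e]; exact h

/-- expansions of `φ|g` -/
theorem phi_HE (N : ℕ) (hN : 1 ≤ N) (g : SL(2, ℤ)) (S : Subfield ℂ)
    (hS : zetaC (N / Int.gcd (g 1 0 * g 1 1) N) ∈ S) :
    ∃ (p : PowerSeries ℂ) (d : ℤ), 0 < d ∧ (d = 1 ↔ (N : ℤ) ∣ g 1 0) ∧ HE N (phi N ∣[(4 : ℤ)] g) p ∧
      p ∈ coeffsIn S ∧ PowerSeries.coeff 0 p = (N : ℂ) ^ 3 * ((d : ℂ) ^ 4)⁻¹ ∧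
      (d = 1 → phi N ∣[(4 : ℤ)] g = phi N) := by
  obtain ⟨a, b, d, h, h', γ, ha, hd, hNad, -, hd1, hdvd, hmul⟩ := decomp N hN g
  have hphi : phi N ∣[(4 : ℤ)] g = (⇑E₄ : ℍ → ℂ) ∣[(4 : ℤ)] (T a b d h) := by
    rw [phi, dif_pos h']
    change ((⇑E₄ : ℍ → ℂ) ∣[(4 : ℤ)] (T N 0 1 h')) ∣[(4 : ℤ)] (Matrix.SpecialLinearGroup.mapGL ℝ g) = _
    rw [← SlashAction.slash_mul, hmul, SlashAction.slash_mul]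
    congr 1
    exact E4_inv γ
  have hNC : (N : ℂ) = a * d := by exact_mod_cast hNad
  have hdC : (d : ℂ) ≠ 0 := by exact_mod_cast hd.ne'
  have haC : (a : ℂ) ≠ 0 := by exact_mod_cast ha.ne'
  have hNC0 : (N : ℂ) ≠ 0 := by rw [hNC]; exact mul_ne_zero haC hdC
  set ζ : ℂ := Complex.exp (2 * Real.pi * Complex.I * b / d) with hζ
  have hζS : ζ ∈ S := by
    set N' : ℕ := N / Int.gcd (g 1 0 * g 1 1) N with hN'
    obtain ⟨e, he⟩ := hdvd
    have hN'0 : (N' : ℂ) ≠ 0 := by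
      have hG : Int.gcd (g 1 0 * g 1 1) N ∣ N := by
        have := Int.gcd_dvd_right (g 1 0 * g 1 1) (N : ℤ)
        exact_mod_cast this
      have := Nat.div_pos (Nat.le_of_dvd (by omega) hG) (Nat.pos_of_dvd_of_pos hG (by omega))
      exact_mod_cast this.ne'
    have heC : (N' : ℂ) * b = d * e := by exact_mod_cast he
    have : ζ = zetaC N' ^ e := by
      rw [hζ, zetaC, ← Complex.exp_int_mul]
      congr 1
      field_simp
      linear_combination heC
    rw [this]
    exact zpow_mem hS e
  have hsum : ∀ τ : ℍ, HasSum (fun n : ℕ => ((N : ℂ) ^ 3 * ((d : ℂ) ^ 4)⁻¹ * ((qExpansion 1 E₄).coeff n * ζ ^ n)) *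
      Function.Periodic.qParam (N : ℝ) (τ : ℂ) ^ (n * (a.toNat ^ 2))) ((phi N ∣[(4 : ℤ)] g) τ) := by
    intro τ
    obtain ⟨h1, h2⟩ := T_slash (b := b) ha hd h τ
    rw [hphi, h1, ← hNC]
    have := (E4_hasSum (T a b d h • τ)).mul_left ((N : ℂ) ^ 3 * ((d : ℂ) ^ 4)⁻¹)
    refine hasSum_congr_fun this fun n => ?_
    rw [h2, mul_assoc, mul_assoc, mul_assoc, mul_assoc]
    congr 3
    have haN : ((a.toNat : ℕ) : ℂ) = (a : ℂ) := by
      have : ((a.toNat : ℕ) : ℤ) = a := Int.toNat_of_nonneg ha.le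
      exact_mod_cast this
    rw [mul_comm n, pow_mul, ← mul_pow, qParam_pow, hζ, ← Complex.exp_add, Function.Periodic.qParam]
    congr 2
    push_cast
    rw [haN, hNC]
    field_simp
    ring
  have ht : 0 < a.toNat ^ 2 := by
    have : 0 < a.toNat := by omega
    positivity
  refine ⟨_, d, hd, hd1, HE_extend ht hsum, mem_coeffsIn.mpr fun n => ?_, ?_, ?_⟩
  · rw [PowerSeries.coeff_mk]
    refine extend_mem ht (fun n => ?_) n
    exact S.mul_mem (S.mul_mem (pow_mem (natCast_mem S _) _) (S.inv_mem (pow_mem (intCast_mem S _) _)))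
      (S.mul_mem (E4_coeff_mem S n) (pow_mem hζS n))
  · have hinj : Function.Injective (fun n : ℕ => n * (a.toNat ^ 2)) := fun a b hab =>
      Nat.eq_of_mul_eq_mul_right ht hab
    rw [PowerSeries.coeff_mk]
    have := hinj.extend_apply (fun n : ℕ => ((N : ℂ) ^ 3 * ((d : ℂ) ^ 4)⁻¹ * ((qExpansion 1 E₄).coeff n * ζ ^ n))) 0 0
    rw [zero_mul] at this
    rw [this, show (qExpansion 1 E₄).coeff 0 = 1 from E_qExpansion_coeff_zero (k := 4) (by norm_num) ⟨2, rfl⟩]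
    simp
  · intro h1
    subst h1
    obtain rfl : a = N := by rw [hNad, mul_one]
    rw [hphi, phi, dif_pos h']
    have hT : T N b 1 h = Matrix.SpecialLinearGroup.mapGL ℝ (ModularGroup.T ^ b) * T N 0 1 h' := by
      apply Matrix.GeneralLinearGroup.ext
      intro i j
      rw [Units.val_mul, mapGL_mat, T_coe, T_coe, ModularGroup.coe_T_zpow, Matrix.mul_fin_two]
      fin_cases i <;> fin_cases j <;> simp
    rw [hT, SlashAction.slash_mul]
    congr 1
    exact E4_inv _

end S6

namespace S6

open EisensteinSeries ModularForm
open scoped Manifold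

lemma pow_slash_SL (F : ℍ → ℂ) (k : ℤ) (g : SL(2, ℤ)) (n : ℕ) :
    (F ^ n) ∣[(n * k : ℤ)] g = (F ∣[k] g) ^ n := by
  induction n with
  | zero =>
    simp only [pow_zero, Nat.cast_zero, zero_mul]
    exact is_invariant_one g
  | succ n ih =>
    rw [pow_succ, pow_succ, ← ih, ← mul_slash_SL2]
    congr 1
    push_cast; ring

/-- monomials -/
def mon (N : ℕ) (t : ℕ × ℕ × ℕ) : ℍ → ℂ :=
  (⇑E₄ : ℍ → ℂ) ^ t.1 * (⇑E₆ : ℍ → ℂ) ^ t.2.1 * phi N ^ t.2.2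

lemma mon_slash (N : ℕ) (t : ℕ × ℕ × ℕ) {w : ℤ} (h : (4 * t.1 + 6 * t.2.1 + 4 * t.2.2 : ℤ) = w) (g : SL(2, ℤ)) :
    mon N t ∣[w] g = (⇑E₄ : ℍ → ℂ) ^ t.1 * (⇑E₆ : ℍ → ℂ) ^ t.2.1 * (phi N ∣[(4 : ℤ)] g) ^ t.2.2 := by
  have h1 := pow_slash_SL (⇑E₄) 4 g t.1
  have h2 := pow_slash_SL (⇑E₆) 6 g t.2.1
  have h3 := pow_slash_SL (phi N) 4 g t.2.2
  rw [E4_inv] at h1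
  rw [E6_inv] at h2
  have h4 := mul_slash_SL2 (t.1 * 4) (t.2.1 * 6) g ((⇑E₄ : ℍ → ℂ) ^ t.1) ((⇑E₆ : ℍ → ℂ) ^ t.2.1)
  have h5 := mul_slash_SL2 (t.1 * 4 + t.2.1 * 6) (t.2.2 * 4) g ((⇑E₄ : ℍ → ℂ) ^ t.1 * (⇑E₆ : ℍ → ℂ) ^ t.2.1)
    (phi N ^ t.2.2)
  rw [h4, h1, h2, h3] at h5
  rw [← h5, mon]
  congr 1
  rw [← h]; ring

lemma mon_HE (N : ℕ) (hN : 1 ≤ N) (t : ℕ × ℕ × ℕ) {w : ℤ}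
    (h : (4 * t.1 + 6 * t.2.1 + 4 * t.2.2 : ℤ) = w) (g : SL(2, ℤ)) (S : Subfield ℂ)
    (hS : zetaC (N / Int.gcd (g 1 0 * g 1 1) N) ∈ S) :
    ∃ p, HE N (mon N t ∣[w] g) p ∧ p ∈ coeffsIn S := by
  obtain ⟨p4, h4, h4'⟩ := E4_HE hN S
  obtain ⟨p6, h6, h6'⟩ := E6_HE hN S
  obtain ⟨p, d, -, -, hp, hp', -⟩ := phi_HE N hN g S hS
  rw [mon_slash N t h g]
  exact ⟨_, ((h4.pow t.1).mul (h6.pow t.2.1)).mul (hp.pow t.2.2),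
    mul_mem (mul_mem (pow_mem h4' _) (pow_mem h6' _)) (pow_mem hp' _)⟩

/-- index set of monomials of weight w -/
abbrev Idx (w : ℤ) := {t : ℕ × ℕ × ℕ // (4 * t.1 + 6 * t.2.1 + 4 * t.2.2 : ℤ) = w}

/-- span of monomials of weight w -/
def V (N : ℕ) (w : ℤ) : Submodule ℂ (ℍ → ℂ) :=
  Submodule.span ℂ (Set.range fun t : Idx w => mon N t.1)

lemma V_of_LOne (N : ℕ) {w : ℤ} {F : ℍ → ℂ} (hF : F ∈ LOne w) (i : ℕ) {w' : ℤ}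
    (h : w' = w + 4 * i) : F * phi N ^ i ∈ V N w' := by
  induction hF using Submodule.span_induction with
  | mem x hx =>
    obtain ⟨a, b, h', rfl⟩ := hx
    exact Submodule.subset_span ⟨⟨(a, b, i), by simp only []; linarith⟩, rfl⟩
  | zero => simp
  | add x y _ _ hx hy => rw [add_mul]; exact add_mem hx hy
  | smul c x _ hx => rw [smul_mul_assoc]; exact Submodule.smul_mem _ _ hx

/-! ### phi -/

lemma phi_mdiff (N : ℕ) : MDiff (phi N) := by
  unfold phi
  split_ifs with h
  · exact MDifferentiable.slash E₄.holo' _ _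
  · exact mdifferentiable_const

lemma zetaC_one : zetaC 1 = 1 := by
  simp [zetaC]

lemma zeta_top (N : ℕ) (g : SL(2, ℤ)) : zetaC (N / Int.gcd (g 1 0 * g 1 1) N) ∈ (⊤ : Subfield ℂ) := trivial

lemma phi_inv (N : ℕ) (hN : 1 ≤ N) (γ : SL(2, ℤ)) (hγ : γ ∈ Gamma0 N) : phi N ∣[(4 : ℤ)] γ = phi N := by
  obtain ⟨p, d, -, hd, -, -, -, h⟩ := phi_HE N hN γ ⊤ (zeta_top N γ)
  refine h (hd.mpr ?_)
  rw [Gamma0_mem] at hγ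
  exact (ZMod.intCast_zmod_eq_zero_iff_dvd _ _).mp hγ

lemma phi_bdd (N : ℕ) (hN : 1 ≤ N) (γ : SL(2, ℤ)) : IsBoundedAtImInfty (phi N ∣[(4 : ℤ)] γ) := by
  obtain ⟨p, d, -, hd, hp, -, -, h⟩ := phi_HE N hN γ ⊤ (zeta_top N γ)
  exact hp.bdd hN

lemma phi_sub (N : ℕ) (hN : 1 ≤ N) (γ : SL(2, ℤ)) :
    ∃ p, HE N (phi N - phi N ∣[(4 : ℤ)] γ) p ∧ (γ ∉ Gamma0 N → p ≠ 0) := by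
  obtain ⟨p, d, hd0, hd, hp, -, hc, -⟩ := phi_HE N hN γ ⊤ (zeta_top N γ)
  obtain ⟨p1, d1, -, hd1, hp1, -, hc1, h1⟩ := phi_HE N hN 1 ⊤ (zeta_top N 1)
  have hd1' : d1 = 1 := hd1.mpr (by simp)
  rw [h1 hd1'] at hp1
  refine ⟨_, hp1.sub hp, ?_⟩
  intro hγ h0
  apply hγ
  have h2 := sub_eq_zero.mp h0
  rw [h2, hc, hd1'] at hc1
  have hN0 : (N : ℂ) ≠ 0 := by exact_mod_cast (by omega : N ≠ 0)
  have h3 := mul_left_cancel₀ (pow_ne_zero 3 hN0) hc1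
  have h4 : (d : ℂ) ^ 4 = 1 := by
    rw [inv_inj] at h3; simpa using h3
  have h5 : d ^ 4 = 1 := by exact_mod_cast h4
  have h6 : d = 1 := by
    exact (pow_eq_one_iff_of_nonneg hd0.le (by norm_num)).mp h5
  rw [Gamma0_mem]
  exact (ZMod.intCast_zmod_eq_zero_iff_dvd _ _).mpr (hd.mp h6)

end S6

namespace S6

open EisensteinSeries ModularForm
open scoped Manifold

/-- holomorphic functions bounded at infinity -/
def HB : Subring (ℍ → ℂ) where
  carrier := {F | MDiff F ∧ IsBoundedAtImInfty F}
  mul_mem' ha hb := ⟨ha.1.mul hb.1, ha.2.mul hb.2⟩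
  one_mem' := ⟨mdifferentiable_const, Filter.const_boundedAtFilter _ _⟩
  add_mem' ha hb := ⟨ha.1.add hb.1, ha.2.add hb.2⟩
  zero_mem' := ⟨mdifferentiable_const, Filter.const_boundedAtFilter _ _⟩
  neg_mem' ha := ⟨ha.1.neg, ha.2.neg⟩

open Polynomial in
lemma prod_coeff_mem {ι : Type*} [DecidableEq ι] (s : Finset ι) (Φ : ι → ℍ → ℂ) (h : ∀ t, Φ t ∈ HB) (i : ℕ) :
    (∏ t ∈ s, (X - C (Φ t))).coeff i ∈ HB := by
  induction s using Finset.induction_on generalizing i with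
  | empty =>
    rw [Finset.prod_empty, coeff_one]
    split_ifs
    · exact one_mem _
    · exact zero_mem _
  | insert a s ha ih =>
    rw [Finset.prod_insert ha, mul_comm]
    cases i with
    | zero =>
      rw [mul_coeff_zero]
      refine mul_mem (ih 0) ?_
      simpa using h a
    | succ i =>
      rw [coeff_mul_X_sub_C]
      exact sub_mem (ih i) (mul_mem (ih _) (h a))

open Polynomial in
lemma prod_coeff_slash {ι : Type*} [DecidableEq ι] (s : Finset ι) (Φ : ι → ℍ → ℂ) (g : SL(2, ℤ)) (i : ℕ) :
    (∏ t ∈ s, (X - C (Φ t))).coeff i ∣[(4 * (s.card - i) : ℤ)] g =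
      (∏ t ∈ s, (X - C (Φ t ∣[(4 : ℤ)] g))).coeff i := by
  induction s using Finset.induction_on generalizing i with
  | empty =>
    rw [Finset.prod_empty, Finset.prod_empty, coeff_one]
    split_ifs with h
    · subst h
      simpa using is_invariant_one g
    · exact SlashAction.zero_slash _ _
  | insert a s ha ih =>
    rw [Finset.prod_insert ha, Finset.prod_insert ha, mul_comm (X - C (Φ a)), mul_comm (X - C (Φ a ∣[(4 : ℤ)] g)),
      Finset.card_insert_of_notMem ha]
    cases i with
    | zero =>
      rw [mul_coeff_zero, mul_coeff_zero, ← ih]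
      have h1 : (X - C (Φ a)).coeff 0 = - Φ a := by simp
      have h2 : (X - C (Φ a ∣[(4 : ℤ)] g)).coeff 0 = - (Φ a ∣[(4 : ℤ)] g) := by simp
      rw [h1, h2, ← SlashAction.neg_slash, ← mul_slash_SL2,
        show (4 * (((s.card + 1 : ℕ) : ℤ) - ((0 : ℕ) : ℤ))) = 4 * ((s.card : ℤ) - ((0 : ℕ) : ℤ)) + 4 by
          push_cast; ring]
    | succ i =>
      rw [coeff_mul_X_sub_C, coeff_mul_X_sub_C, ← ih, ← ih, ← mul_slash_SL2,
        show (4 * (((s.card + 1 : ℕ) : ℤ) - ((i + 1 : ℕ) : ℤ))) = 4 * ((s.card : ℤ) - (i : ℤ)) by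
          push_cast; ring,
        show (4 * ((s.card : ℤ) - ((i + 1 : ℕ) : ℤ)) + 4) = 4 * ((s.card : ℤ) - (i : ℤ)) by
          push_cast; ring]
      generalize (4 * ((s.card : ℤ) - (i : ℤ))) = w
      rw [sub_eq_add_neg, sub_eq_add_neg, SlashAction.add_slash, SlashAction.neg_slash]

/-- bundle a level one form -/
def mkLevelOne (w : ℤ) (F : ℍ → ℂ) (h1 : ∀ g : SL(2, ℤ), F ∣[w] g = F) (h2 : F ∈ HB) : ModularForm 𝒮ℒ w where
  toFun := F
  slash_action_eq' := by
    rintro _ ⟨g, rfl⟩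
    exact h1 g
  holo' := h2.1
  bdd_at_cusps' := by
    intro c hc
    rw [OnePoint.isBoundedAt_iff_forall_SL2Z hc]
    intro γ _
    rw [h1]
    exact h2.2

section
variable (N : ℕ)

/-- coset space -/
abbrev X0 := SL(2, ℤ) ⧸ Gamma0 N

/-- conjugates -/
def cs (k : ℤ) (F : ℍ → ℂ) (q : X0 N) : ℍ → ℂ := F ∣[k] (q.out)⁻¹

variable {N}

lemma cs_mk {k : ℤ} {F : ℍ → ℂ} (hF : ∀ γ ∈ Gamma0 N, F ∣[k] γ = F) (h : SL(2, ℤ)) :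
    cs N k F (h : X0 N) = F ∣[k] h⁻¹ := by
  obtain ⟨γ, hγ⟩ := QuotientGroup.mk_out_eq_mul (Gamma0 N) h
  rw [cs, hγ, mul_inv_rev, SlashAction.slash_mul, hF _ (inv_mem γ.2)]

lemma cs_slash {k : ℤ} {F : ℍ → ℂ} (hF : ∀ γ ∈ Gamma0 N, F ∣[k] γ = F) (g : SL(2, ℤ)) (q : X0 N) :
    cs N k F q ∣[k] g = cs N k F (g⁻¹ • q) := by
  induction q using QuotientGroup.induction_on with | H h =>
  rw [cs_mk hF, ← SlashAction.slash_mul]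
  have : g⁻¹ • (h : X0 N) = ((g⁻¹ * h : SL(2, ℤ)) : X0 N) := rfl
  rw [this, cs_mk hF, mul_inv_rev, inv_inv]

end

/-- the different -/
def delta (N : ℕ) [Fintype (X0 N)] [DecidableEq (X0 N)] : ℍ → ℂ :=
  ∏ t ∈ Finset.univ.erase ((1 : SL(2, ℤ)) : X0 N), (phi N - cs N 4 (phi N) t)

open Polynomial in
theorem lagrange (N : ℕ) (hN : 1 ≤ N) [Fintype (X0 N)] [DecidableEq (X0 N)] (k : ℤ) (F : ℍ → ℂ)
    (hF : ∀ γ ∈ Gamma0 N, F ∣[k] γ = F) (hol : MDiff F) (hb : ∀ g : SL(2, ℤ), IsBoundedAtImInfty (F ∣[k] g)) :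
    F * delta N ∈ V N (k + 4 * ((Fintype.card (X0 N) : ℤ) - 1)) := by
  have hphi := phi_inv N hN
  set Φ := cs N 4 (phi N) with hΦ
  set P : X0 N → (ℍ → ℂ)[X] := fun q => ∏ t ∈ Finset.univ.erase q, (X - C (Φ t)) with hP
  have hcard : ∀ q : X0 N, (Finset.univ.erase q).card = Fintype.card (X0 N) - 1 := fun q => by
    rw [Finset.card_erase_of_mem (Finset.mem_univ q), Finset.card_univ]
  have hpos : 0 < Fintype.card (X0 N) := Fintype.card_pos_iff.mpr ⟨((1 : SL(2, ℤ)) : X0 N)⟩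
  have hcard' : ∀ q : X0 N, ((Finset.univ.erase q).card : ℤ) = (Fintype.card (X0 N) : ℤ) - 1 := fun q => by
    rw [hcard]; omega
  have hΦHB : ∀ t, Φ t ∈ HB := fun t => ⟨(phi_mdiff N).slash _ _, phi_bdd N hN _⟩
  have hFHB : ∀ q, cs N k F q ∈ HB := fun t => ⟨hol.slash _ _, hb _⟩
  have hdeg : ∀ q, (P q).natDegree < Fintype.card (X0 N) := by
    intro q
    refine lt_of_le_of_lt (natDegree_prod_le _ _) ?_
    have : ∑ t ∈ Finset.univ.erase q, (X - C (Φ t)).natDegree ≤ ∑ t ∈ Finset.univ.erase q, 1 :=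
      Finset.sum_le_sum fun t _ => natDegree_X_sub_C_le _
    simp only [Finset.sum_const, smul_eq_mul, mul_one, hcard] at this
    omega
  have heval : F * delta N = ∑ i ∈ Finset.range (Fintype.card (X0 N)),
      (∑ q, cs N k F q * (P q).coeff i) * phi N ^ i := by
    have h1 : F * delta N = ∑ q, cs N k F q * (P q).eval (phi N) := by
      rw [Finset.sum_eq_single ((1 : SL(2, ℤ)) : X0 N)]
      · rw [cs_mk hF, inv_one, SlashAction.slash_one, delta, hP, eval_prod]
        simp [hΦ]
      · intro q _ hq
        rw [hP, eval_prod, Finset.prod_eq_zero (i := ((1 : SL(2, ℤ)) : X0 N))]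
        · simp
        · simp [Ne.symm hq]
        · rw [hΦ, cs_mk hphi, inv_one, SlashAction.slash_one]
          simp
      · simp
    rw [h1]
    simp_rw [Finset.sum_mul]
    rw [Finset.sum_comm]
    refine Finset.sum_congr rfl fun q _ => ?_
    rw [eval_eq_sum_range' (hdeg q), Finset.mul_sum]
    refine Finset.sum_congr rfl fun i _ => ?_
    ring
  rw [heval]
  refine sum_mem fun i _ => ?_
  refine V_of_LOne N (w := k + 4 * ((Fintype.card (X0 N) : ℤ) - 1 - i)) ?_ i (by ring)
  have hinv : ∀ g : SL(2, ℤ), (∑ q, cs N k F q * (P q).coeff i) ∣[k + 4 * ((Fintype.card (X0 N) : ℤ) - 1 - i)] g =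
      ∑ q, cs N k F q * (P q).coeff i := by
    intro g
    rw [SlashAction.sum_slash]
    refine Finset.sum_equiv (MulAction.toPerm g⁻¹) (by simp) fun q _ => ?_
    rw [mul_slash_SL2, cs_slash hF]
    congr 1
    have := prod_coeff_slash (Finset.univ.erase q) Φ g i
    rw [hcard'] at this
    rw [hP, this]
    congr 1
    refine Finset.prod_equiv (MulAction.toPerm g⁻¹) (by simp) fun t _ => ?_
    rw [hΦ, cs_slash hphi]
    rfl
  have hmem : (∑ q, cs N k F q * (P q).coeff i) ∈ HB :=
    sum_mem fun q _ => mul_mem (hFHB q) (prod_coeff_mem _ _ hΦHB i)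
  exact levelOne_mem _ _ (mkLevelOne _ _ hinv hmem) rfl

theorem delta_ne_zero (N : ℕ) (hN : 1 ≤ N) [Fintype (X0 N)] [DecidableEq (X0 N)] : delta N ≠ 0 := by
  have hphi := phi_inv N hN
  choose p hp hp' using fun t : X0 N => phi_sub N hN (t.out)⁻¹
  intro h0
  have h1 : HE N (delta N) (∏ t ∈ Finset.univ.erase ((1 : SL(2, ℤ)) : X0 N), p t) :=
    HE.prod fun t _ => hp t
  rw [h0] at h1
  have h2 := HE.eq_zero hN h1
  rw [Finset.prod_eq_zero_iff] at h2
  obtain ⟨t, ht, hpt⟩ := h2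
  refine hp' t ?_ hpt
  intro hmem
  have h3 : t = ((1 : SL(2, ℤ)) : X0 N) := by
    rw [← QuotientGroup.out_eq' t, eq_comm, QuotientGroup.eq, inv_one, one_mul]
    exact inv_mem_iff.mp hmem
  simp [h3] at ht

end S6

namespace S6

open EisensteinSeries ModularForm PowerSeries
open scoped Manifold

lemma V_exists {N : ℕ} {w : ℤ} {F : ℍ → ℂ} (hF : F ∈ V N w) :
    ∃ (s : Finset (Idx w)) (c : Idx w → ℂ), F = ∑ t ∈ s, c t • mon N t.1 := by
  obtain ⟨c, hc⟩ := Finsupp.mem_span_range_iff_exists_finsupp.mp hF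
  exact ⟨c.support, c, hc.symm⟩

lemma comb_slash {N : ℕ} {w : ℤ} (s : Finset (Idx w)) (c : Idx w → ℂ) (g : SL(2, ℤ)) :
    (∑ t ∈ s, c t • mon N t.1) ∣[w] g = ∑ t ∈ s, c t • (mon N t.1 ∣[w] g) := by
  rw [SlashAction.sum_slash]
  simp only [SL_smul_slash]

lemma comb_inv {N : ℕ} (hN : 1 ≤ N) {w : ℤ} (s : Finset (Idx w)) (c : Idx w → ℂ) (γ : SL(2, ℤ))
    (hγ : γ ∈ Gamma0 N) :
    (∑ t ∈ s, c t • mon N t.1) ∣[w] γ = ∑ t ∈ s, c t • mon N t.1 := by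
  rw [comb_slash]
  refine Finset.sum_congr rfl fun t _ => ?_
  rw [mon_slash N t.1 t.2, phi_inv N hN γ hγ, mon]

lemma smul_mem_coeffsIn {S : Subfield ℂ} {c : ℂ} {p : PowerSeries ℂ} (hc : c ∈ S) (hp : p ∈ coeffsIn S) :
    c • p ∈ coeffsIn S := by
  rw [mem_coeffsIn] at hp ⊢
  intro n
  simpa using S.mul_mem hc (hp n)

lemma comb_HE {N : ℕ} (hN : 1 ≤ N) {w : ℤ} (s : Finset (Idx w)) (c : Idx w → ℂ) (g : SL(2, ℤ))
    (S : Subfield ℂ) (hS : zetaC (N / Int.gcd (g 1 0 * g 1 1) N) ∈ S) (hc : ∀ t, c t ∈ S) :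
    ∃ p, HE N ((∑ t ∈ s, c t • mon N t.1) ∣[w] g) p ∧ p ∈ coeffsIn S := by
  choose p hp hp' using fun t : Idx w => mon_HE N hN t.1 t.2 g S hS
  rw [comb_slash]
  exact ⟨_, HE.sum fun t _ => (hp t).smul (c t), sum_mem fun t _ => smul_mem_coeffsIn (hc t) (hp' t)⟩

lemma mon_HE_one (N : ℕ) (hN : 1 ≤ N) (w : ℤ) (S : Subfield ℂ) (t : Idx w) :
    ∃ p, HE N (mon N t.1) p ∧ p ∈ coeffsIn S := by
  have := mon_HE N hN t.1 t.2 1 S (by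
    have : Int.gcd ((1 : SL(2, ℤ)) 1 0 * (1 : SL(2, ℤ)) 1 1) N = N := by simp
    rw [this, Nat.div_self (by omega), zetaC_one]
    exact S.one_mem)
  rwa [SlashAction.slash_one] at this

/-- apply a linear form to coefficients -/
def R {K : Subfield ℂ} (ρ : ℂ →ₗ[K] K) : PowerSeries ℂ →ₗ[K] PowerSeries ℂ where
  toFun p := PowerSeries.mk fun n => (ρ (coeff n p) : ℂ)
  map_add' p q := by ext n; simp
  map_smul' c p := by
    ext n
    have h : coeff n (c • p) = c • coeff n p := rfl
    have h' : ∀ q : PowerSeries ℂ, coeff n (c • q) = (c : ℂ) * coeff n q := fun q => rfl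
    rw [coeff_mk, h, map_smul, RingHom.id_apply, h', coeff_mk]
    simp

lemma coeff_R {K : Subfield ℂ} (ρ : ℂ →ₗ[K] K) (p : PowerSeries ℂ) (n : ℕ) :
    coeff n (R ρ p) = (ρ (coeff n p) : ℂ) := by
  simp [R]

lemma rho_mul {K : Subfield ℂ} (ρ : ℂ →ₗ[K] K) (x y : ℂ) (hx : x ∈ K) :
    ((ρ (x * y) : K) : ℂ) = x * (ρ y : ℂ) := by
  have : x * y = (⟨x, hx⟩ : K) • y := rfl
  rw [this, map_smul]
  rfl

lemma R_mul {K : Subfield ℂ} (ρ : ℂ →ₗ[K] K) (p q : PowerSeries ℂ) (hp : p ∈ coeffsIn K) :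
    R ρ (p * q) = p * R ρ q := by
  ext n
  rw [mem_coeffsIn] at hp
  rw [coeff_R, coeff_mul, coeff_mul, map_sum]
  push_cast
  refine Finset.sum_congr rfl fun x _ => ?_
  rw [rho_mul ρ _ _ (hp _), coeff_R]

lemma R_smul {K : Subfield ℂ} (ρ : ℂ →ₗ[K] K) (c : ℂ) (p : PowerSeries ℂ) (hp : p ∈ coeffsIn K) :
    R ρ (c • p) = (ρ c : ℂ) • p := by
  ext n
  rw [mem_coeffsIn] at hp
  rw [coeff_R, coeff_smul, coeff_smul, smul_eq_mul, smul_eq_mul, mul_comm, rho_mul ρ _ _ (hp _), mul_comm]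

lemma SLlow_mem (N : ℕ) (e : ℤ) : ∃ γ : SL(2, ℤ), γ ∈ Gamma0 N ∧ ∀ τ : ℍ, denom γ τ = 1 + e * N * (τ : ℂ) := by
  obtain ⟨γ, h0, h1⟩ : ∃ γ : SL(2, ℤ), γ 1 0 = e * N ∧ γ 1 1 = 1 := by
    let γ : SL(2, ℤ) := ⟨!![1, 0; e * N, 1], by simp⟩
    exact ⟨γ, by simp [γ], by simp [γ]⟩
  refine ⟨γ, ?_, ?_⟩
  · rw [Gamma0_mem, h0]; simp
  · intro τ
    rw [ModularGroup.denom_apply, h0, h1]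
    push_cast
    ring

lemma two_weights {N : ℕ} (hN : 1 ≤ N) {w k : ℤ} (hk : 1 ≤ k) {G : ℍ → ℂ}
    (h1 : ∀ γ ∈ Gamma0 N, G ∣[w] γ = G) (h2 : ∀ γ ∈ Gamma0 N, G ∣[k + w] γ = G) : G = 0 := by
  funext τ
  by_contra h0
  have key : ∀ γ ∈ Gamma0 N, ‖denom γ τ‖ = 1 := by
    intro γ hγ
    have e1 := congrFun (h1 γ hγ) τ
    have e2 := congrFun (h2 γ hγ) τ
    rw [SL_slash_apply] at e1 e2
    have hd : denom γ τ ≠ 0 := denom_ne_zero _ _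
    rw [neg_add, zpow_add₀ hd, mul_left_comm, e1] at e2
    have e3 : denom γ τ ^ (-k) = 1 := by
      have h0' : G τ ≠ 0 := h0
      exact mul_right_cancel₀ h0' (by rw [e2, one_mul])
    rw [zpow_neg, inv_eq_one] at e3
    lift k to ℕ using by omega
    rw [zpow_natCast] at e3
    exact norm_eq_one_of_pow_eq_one e3 (by omega)
  obtain ⟨γ, hγ, hd⟩ := SLlow_mem N 1
  obtain ⟨γ', hγ', hd'⟩ := SLlow_mem N (-1)
  have k1 := key γ hγ
  have k2 := key γ' hγ'
  rw [hd] at k1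
  rw [hd'] at k2
  have k1' : Complex.normSq (1 + ((1 : ℤ) : ℂ) * N * τ) = 1 := by rw [Complex.normSq_eq_norm_sq, k1]; norm_num
  have k2' : Complex.normSq (1 + ((-1 : ℤ) : ℂ) * N * τ) = 1 := by rw [Complex.normSq_eq_norm_sq, k2]; norm_num
  rw [Complex.normSq_apply] at k1' k2'
  simp at k1' k2'
  have him := τ.im_pos
  have hNR : (1 : ℝ) ≤ N := by exact_mod_cast hN
  have : 0 < (N : ℝ) * τ.im := by positivity
  nlinarith [sq_nonneg ((N : ℝ) * τ.re), mul_pos this this]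

theorem descent {N : ℕ} (hN : 1 ≤ N) {w k : ℤ} (hk : 1 ≤ k) (K : Subfield ℂ) {F D : ℍ → ℂ}
    (hF : ∀ γ ∈ Gamma0 N, F ∣[k] γ = F) {p : PowerSeries ℂ} (hp : HE N F p)
    (hpK : ∀ n, n ≠ 0 → coeff n p ∈ K) (hD : D ∈ V N w) (hD0 : D ≠ 0) (hFD : F * D ∈ V N (k + w)) :
    ∃ (s : Finset (Idx w)) (c : Idx w → ℂ) (s' : Finset (Idx (k + w))) (c' : Idx (k + w) → ℂ),
      (∀ t, c t ∈ K) ∧ (∀ t, c' t ∈ K) ∧ (∑ t ∈ s, c t • mon N t.1) ≠ 0 ∧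
      F * (∑ t ∈ s, c t • mon N t.1) = ∑ t ∈ s', c' t • mon N t.1 := by
  obtain ⟨s, d, hd⟩ := V_exists hD
  obtain ⟨s', e, he⟩ := V_exists hFD
  choose m hm hmK using mon_HE_one N hN w K
  choose m' hm' hmK' using mon_HE_one N hN (k + w) K
  have hDE : HE N D (∑ t ∈ s, d t • m t) := by
    rw [hd]; exact HE.sum fun t _ => (hm t).smul _
  have hPE : HE N (F * D) (∑ t ∈ s', e t • m' t) := by
    rw [he]; exact HE.sum fun t _ => (hm' t).smul _
  set Dh := ∑ t ∈ s, d t • m t with hDh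
  set Ph := ∑ t ∈ s', e t • m' t with hPh
  have heq : p * Dh = Ph := (hp.mul hDE).unique hN hPE
  have hDh0 : Dh ≠ 0 := hDE.ne_zero hD0
  obtain ⟨n, hn⟩ : ∃ n, coeff n Dh ≠ 0 := by
    by_contra! h
    exact hDh0 (PowerSeries.ext fun n => by simpa using h n)
  obtain ⟨ρ, hρ⟩ : ∃ ρ : ℂ →ₗ[K] K, ρ (coeff n Dh) ≠ 0 := by
    by_contra! h
    exact hn ((Module.forall_dual_apply_eq_zero_iff K _).mp h)
  set a0 := coeff 0 p with ha0
  set p1 := p - a0 • (1 : PowerSeries ℂ) with hp1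
  have hp1K : p1 ∈ coeffsIn K := by
    rw [mem_coeffsIn]
    intro n
    rw [hp1, map_sub, coeff_smul, coeff_one]
    by_cases h : n = 0
    · subst h; simp [ha0]
    · simpa [h] using hpK n h
  have hR : p1 * R ρ Dh = R ρ Ph - R ρ (a0 • Dh) := by
    rw [← R_mul ρ _ _ hp1K, ← map_sub, ← heq, hp1, sub_mul, smul_mul_assoc, one_mul]
  have hR1 : R ρ Dh = ∑ t ∈ s, (ρ (d t) : ℂ) • m t := by
    rw [hDh, map_sum]
    exact Finset.sum_congr rfl fun t _ => R_smul ρ _ _ (hmK t)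
  have hR2 : R ρ (a0 • Dh) = ∑ t ∈ s, (ρ (a0 * d t) : ℂ) • m t := by
    rw [hDh, Finset.smul_sum, map_sum]
    refine Finset.sum_congr rfl fun t _ => ?_
    rw [smul_smul, R_smul ρ _ _ (hmK t)]
  have hR3 : R ρ Ph = ∑ t ∈ s', (ρ (e t) : ℂ) • m' t := by
    rw [hPh, map_sum]
    exact Finset.sum_congr rfl fun t _ => R_smul ρ _ _ (hmK' t)
  set D1 : ℍ → ℂ := ∑ t ∈ s, (ρ (d t) : ℂ) • mon N t.1 with hD1
  set D2 : ℍ → ℂ := ∑ t ∈ s, (ρ (a0 * d t) : ℂ) • mon N t.1 with hD2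
  set P1 : ℍ → ℂ := ∑ t ∈ s', (ρ (e t) : ℂ) • mon N t.1 with hP1
  have hE1 : HE N D1 (R ρ Dh) := by rw [hR1]; exact HE.sum fun t _ => (hm t).smul _
  have hE2 : HE N D2 (R ρ (a0 • Dh)) := by rw [hR2]; exact HE.sum fun t _ => (hm t).smul _
  have hE3 : HE N P1 (R ρ Ph) := by rw [hR3]; exact HE.sum fun t _ => (hm' t).smul _
  have hfun : (F - a0 • (1 : ℍ → ℂ)) * D1 = P1 - D2 := by
    have h1 := (hp.sub (HE.one.smul a0)).mul hE1
    rw [← hp1, hR] at h1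
    exact h1.ext (hE3.sub hE2)
  have hG : F * D1 - P1 = a0 • D1 - D2 := by
    rw [sub_mul, smul_mul_assoc, one_mul] at hfun
    linear_combination hfun
  have hG0 : F * D1 - P1 = 0 := by
    refine two_weights hN (w := w) hk (fun γ hγ => ?_) (fun γ hγ => ?_)
    · rw [hG, sub_eq_add_neg, SlashAction.add_slash, SlashAction.neg_slash, SL_smul_slash,
        comb_inv hN s _ γ hγ, comb_inv hN s _ γ hγ]
    · rw [sub_eq_add_neg, SlashAction.add_slash, SlashAction.neg_slash, mul_slash_SL2, hF γ hγ,
        comb_inv hN s _ γ hγ, comb_inv hN s' _ γ hγ]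
  refine ⟨s, fun t => (ρ (d t) : ℂ), s', fun t => (ρ (e t) : ℂ), fun t => (ρ (d t)).2, fun t => (ρ (e t)).2, ?_, ?_⟩
  · intro h0
    have h0' : D1 = 0 := h0
    rw [h0'] at hE1
    have := HE.eq_zero hN hE1
    have h3 := coeff_R ρ Dh n
    rw [this, map_zero] at h3
    exact hρ (by exact_mod_cast h3.symm)
  · exact sub_eq_zero.mp hG0

end S6

theorem stmt_6 (N : ℕ) (hN : 1 ≤ N) (k : ℤ) (hk : 1 ≤ k)
    (f : ModularForm (Gamma1 N) k)
    (htriv : ∀ γ : SL(2, ℤ), γ ∈ Gamma0 N → ⇑f ∣[k] γ = ⇑f)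
    (a : ℕ → ℂ) (ha : HasExpansion 1 (⇑f) a)
    (g : SL(2, ℤ)) (N' : ℕ) (hN' : N' = N / Int.gcd (g 1 0 * g 1 1) N)
    (c : ℕ → ℂ) (hc : HasExpansion N (⇑f ∣[k] g) c) :
    ∀ n : ℕ, c n ∈ Subfield.closure ({x : ℂ | ∃ m : ℕ, 1 ≤ m ∧ x = a m} ∪ {zetaC N'}) := by
  classical
  haveI : NeZero N := ⟨by omega⟩
  haveI : Fintype (S6.X0 N) := Fintype.ofFinite _
  set L := Subfield.closure ({x : ℂ | ∃ m : ℕ, 1 ≤ m ∧ x = a m} ∪ {zetaC N'}) with hL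
  set K := Subfield.closure {x : ℂ | ∃ m : ℕ, 1 ≤ m ∧ x = a m} with hK
  have hKL : K ≤ L := Subfield.closure_mono Set.subset_union_left
  have hζ : zetaC (N / Int.gcd (g 1 0 * g 1 1) N) ∈ L := by
    rw [← hN']
    exact Subfield.subset_closure (Or.inr rfl)
  -- the expansion of f
  have hf1 := S6.HE_of_hasExpansion ha
  have hf2 : ∀ τ : ℍ, HasSum (fun n : ℕ => a n * Function.Periodic.qParam (1 : ℝ) (τ : ℂ) ^ n) (f τ) := by
    intro τ
    have := hf1 τ
    simpa only [PowerSeries.coeff_mk, Nat.cast_one] using this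
  have hf := S6.HE_stretch hN hf2
  have hfK : ∀ n, n ≠ 0 → PowerSeries.coeff n (PowerSeries.mk (Function.extend (fun n => n * N) a 0)) ∈ K := by
    intro n hn
    rw [PowerSeries.coeff_mk]
    have hinj : Function.Injective (fun n : ℕ => n * N) := fun a b hab =>
      Nat.eq_of_mul_eq_mul_right (by omega) hab
    by_cases hm : ∃ m, m * N = n
    · obtain ⟨m, rfl⟩ := hm
      rw [hinj.extend_apply a 0 m]
      refine Subfield.subset_closure ⟨m, ?_, rfl⟩
      rcases Nat.eq_zero_or_pos m with h | h
      · simp [h] at hn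
      · exact h
    · rw [Function.extend_apply' _ _ _ hm]
      exact K.zero_mem
  have hbdd : ∀ h : SL(2, ℤ), IsBoundedAtImInfty (⇑f ∣[k] h) := fun h =>
    ModularFormClass.bdd_at_infty_slash f h
  have hD := S6.lagrange N hN 0 1 (fun γ _ => ModularForm.is_invariant_one γ) mdifferentiable_const
    (fun h => by rw [ModularForm.is_invariant_one]; exact Filter.const_boundedAtFilter _ _)
  rw [one_mul, zero_add] at hD
  have hP := S6.lagrange N hN k f htriv f.holo' hbdd
  obtain ⟨s, d, s', e, hd, he, hne, heq⟩ :=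
    S6.descent hN hk K htriv hf hfK hD (S6.delta_ne_zero N hN) hP
  obtain ⟨p, hp, hpL⟩ := S6.comb_HE hN s d g L hζ (fun t => hKL (hd t))
  obtain ⟨r, hr, hrL⟩ := S6.comb_HE hN s' e g L hζ (fun t => hKL (he t))
  rw [← heq, ModularForm.mul_slash_SL2] at hr
  have hcE := S6.HE_of_hasExpansion hc
  have hprod := (hcE.mul hp).unique hN hr
  have hp0 : p ≠ 0 := by
    refine hp.ne_zero fun h0 => hne ?_
    have := congrArg (fun F : ℍ → ℂ => F ∣[(4 * ((Fintype.card (S6.X0 N) : ℤ) - 1))] g⁻¹) h0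
    simp only [← SlashAction.slash_mul, mul_inv_cancel, SlashAction.slash_one, SlashAction.zero_slash] at this
    exact this
  have := S6.coeffsIn_of_mul hpL hp0 (by rw [hprod]; exact hrL)
  intro n
  simpa using S6.mem_coeffsIn.mp this n
end
end

section
/- Let N ≥ 1, k ≥ 1, let χ be a Dirichlet character modulo N, let f ∈ M_k(Γ₀(N), χ), and let g = (A, B; C, D) ∈ SL₂(ℤ). Set N' = N/gcd(CD, N). Let σ be a field automorphism of ℂ that fixes a_n(f) for all n ≥ 1 and satisfies σ(ζ_N) = ζ_N^λ with λ ≡ 1 (mod N'); fix λ' ∈ ℤ with λλ' ≡ 1 (mod N). Then for every n ≥ 0, σ(c_n) = χ(AD − λ'BC) · c_n, where Σ_{n≥0} c_n e^{2πinτ/N} is the Fourier expansion of f |_k g. -/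
open Complex UpperHalfPlane CongruenceSubgroup
open scoped ModularForm MatrixGroups Real

noncomputable section

namespace S8

open PowerSeries
open scoped Manifold

/-- local parameter -/
def qq (M : ℕ) (τ : ℍ) : ℂ := Complex.exp (2 * Real.pi * Complex.I * (τ : ℂ) / M)

lemma qq_eq (M : ℕ) (τ : ℍ) : qq M τ = Function.Periodic.qParam (M : ℝ) τ := by
  simp [qq, Function.Periodic.qParam]

lemma norm_qq_lt (M : ℕ) (hM : 0 < M) (τ : ℍ) : ‖qq M τ‖ < 1 := by
  rw [qq_eq]
  exact Function.Periodic.norm_qParam_lt_one (by exact_mod_cast hM) τ.im_pos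

/-- power-series version of the expansion -/
def HE (M : ℕ) (F : ℍ → ℂ) (p : ℂ⟦X⟧) : Prop :=
  ∀ τ : ℍ, HasSum (fun n : ℕ => coeff n p * qq M τ ^ n) (F τ)

lemma HE_of_hasExpansion {M : ℕ} {F : ℍ → ℂ} {c : ℕ → ℂ} (h : HasExpansion M F c) :
    HE M F (PowerSeries.mk c) := by
  intro τ
  convert h τ using 2 with n
  rw [coeff_mk, qq, ← Complex.exp_nat_mul]
  congr 2
  ring

lemma _root_.HasSum.congr_fun' {f g : ℕ → ℂ} {a : ℂ} (h : HasSum f a) (hfg : ∀ n, g n = f n) :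
    HasSum g a := by
  rwa [funext hfg]

lemma HE.add {M F G p q} (h1 : HE M F p) (h2 : HE M G q) : HE M (F + G) (p + q) := by
  intro τ
  refine ((h1 τ).add (h2 τ)).congr_fun' ?_
  intro n
  simp [add_mul]

lemma HE.neg {M F p} (h1 : HE M F p) : HE M (-F) (-p) := by
  intro τ
  refine ((h1 τ).neg).congr_fun' ?_
  intro n
  simp

lemma HE.mul {M F G p q} (h1 : HE M F p) (h2 : HE M G q) : HE M (F * G) (p * q) := by
  intro τ
  have s1 := (h1 τ).summable.norm
  have s2 := (h2 τ).summable.norm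
  have := (summable_norm_sum_mul_antidiagonal_of_summable_norm s1 s2).of_norm.hasSum
  rw [← tsum_mul_tsum_eq_tsum_sum_antidiagonal_of_summable_norm s1 s2, (h1 τ).tsum_eq,
    (h2 τ).tsum_eq] at this
  refine HasSum.congr_fun' this fun n => ?_
  rw [coeff_mul, Finset.sum_mul]
  refine Finset.sum_congr rfl fun x hx => ?_
  rw [← Finset.HasAntidiagonal.mem_antidiagonal.mp hx, pow_add]
  ring

lemma HE.const (M : ℕ) (c : ℂ) : HE M (fun _ => c) (C c) := by
  intro τ
  convert hasSum_ite_eq 0 c using 2 with n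
  rw [coeff_C]
  split_ifs with h <;> simp [h]

/-- the ring of pairs (function, expansion) -/
def SR (M : ℕ) : Subring ((ℍ → ℂ) × ℂ⟦X⟧) where
  carrier := {x | HE M x.1 x.2}
  mul_mem' h1 h2 := HE.mul h1 h2
  add_mem' h1 h2 := HE.add h1 h2
  neg_mem' h1 := HE.neg h1
  one_mem' := by
    have := HE.const M 1
    rw [map_one] at this
    exact this
  zero_mem' := by
    have := HE.const M 0
    rw [map_zero] at this
    exact this

lemma HE.zero_unique {M : ℕ} (hM : 0 < M) {F : ℍ → ℂ} (hF : F = fun _ => 0) {p : ℂ⟦X⟧}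
    (h : HE M F p) : p = 0 := by
  have hM' : (0 : ℝ) < M := Nat.cast_pos.mpr hM
  have hper : Function.Periodic (F ∘ ofComplex) ((M : ℝ) : ℂ) := by
    intro z; rw [hF]; rfl
  have hd : MDiff F := by rw [hF]; exact mdifferentiable_const
  have hb : IsBoundedAtImInfty F := by rw [hF]; exact Filter.const_boundedAtFilter _ (0 : ℂ)
  have han : AnalyticAt ℂ (cuspFunction (M : ℝ) F) 0 :=
    analyticAt_cuspFunction_zero hM' hper hd hb
  have hu : ∀ τ : ℍ, HasSum (fun m ↦ (fun n => coeff n p) m •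
      Function.Periodic.qParam (M : ℝ) τ ^ m) (F τ) := by
    intro τ; rw [← qq_eq]; exact h τ
  have h1 := (hasFPowerSeriesOnBall_cuspFunction (c := fun n => coeff n p) hM' han hu).hasFPowerSeriesAt
  have h2 : cuspFunction (M : ℝ) F =ᶠ[nhds 0] 0 := by
    have h3 : ∀ᶠ z in nhds (0 : ℂ), z ∈ Metric.ball (0 : ℂ) 1 := Metric.ball_mem_nhds _ one_pos
    filter_upwards [h3] with z hz
    have hz' : ‖z‖ < 1 := by simpa using hz
    have h4 := UpperHalfPlane.hasSum_qExpansion_of_norm_lt hM' hper hd hb hz'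
    have h5 : UpperHalfPlane.qExpansion (M : ℝ) F = 0 := by
      rw [hF]; exact UpperHalfPlane.qExpansion_zero _
    rw [h5] at h4
    simp only [map_zero, zero_smul] at h4
    exact h4.unique hasSum_zero
  have h6 := (h1.congr h2).eq_zero
  ext n
  have := congr_arg (FormalMultilinearSeries.coeff · n) h6
  have h0 : FormalMultilinearSeries.coeff (0 : FormalMultilinearSeries ℂ ℂ ℂ) n = 0 := rfl
  simpa [h0] using this

lemma HE.unique {M : ℕ} (hM : 0 < M) {F p q} (h1 : HE M F p) (h2 : HE M F q) : p = q := by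
  have := h1.add h2.neg
  rw [add_neg_cancel] at this
  have := HE.zero_unique hM rfl this
  exact add_neg_eq_zero.mp this

lemma HE.fun_unique {M : ℕ} {F G p} (h1 : HE M F p) (h2 : HE M G p) : F = G :=
  funext fun τ => (h1 τ).unique (h2 τ)

lemma HE.bdd {M : ℕ} (hM : 0 < M) {F p} (h : HE M F p) : IsBoundedAtImInfty F :=
  UpperHalfPlane.isBoundedAtImInfty_of_hasSum_qExpansion (h := (M : ℝ)) (c := fun n => coeff n p)
    (by exact_mod_cast hM) (fun τ => by rw [← qq_eq]; exact h τ)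

lemma HE.mdiff {M : ℕ} (hM : 0 < M) {F p} (h : HE M F p) : MDiff F := by
  have hM' : (0 : ℝ) < M := by exact_mod_cast hM
  set P : FormalMultilinearSeries ℂ ℂ ℂ := .ofScalars ℂ (fun n => coeff n p) with hP
  have hr : 1 ≤ P.radius := by
    refine le_of_forall_lt_imp_le_of_dense fun r hr ↦ ?_
    rcases eq_or_ne r 0 with rfl | hr'
    · simp
    · lift r to NNReal using hr.ne_top
      apply FormalMultilinearSeries.le_radius_of_summable
      have hr1 : ‖(r : ℂ)‖ < 1 := by simpa using hr
      have hr0 : (r : ℂ) ≠ 0 := by exact_mod_cast hr'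
      have h1 := Function.Periodic.im_invQParam_pos_of_norm_lt_one hM' hr1 hr0
      have := (h ⟨_, h1⟩).summable.norm
      rw [qq_eq] at this
      simp only [Function.Periodic.qParam_right_inv hM'.ne' hr0] at this
      simpa [hP, mul_comm] using this
  have hd : DifferentiableOn ℂ P.sum (Metric.eball 0 1) :=
    ((P.hasFPowerSeriesOnBall (lt_of_lt_of_le one_pos hr)).mono one_pos hr).differentiableOn
  rw [UpperHalfPlane.mdifferentiable_iff]
  have : DifferentiableOn ℂ (fun z : ℂ => P.sum (Function.Periodic.qParam (M : ℝ) z)) {z | 0 < z.im} := by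
    refine hd.comp ?_ ?_
    · exact (Function.Periodic.differentiable_qParam).differentiableOn
    · intro z hz
      have := Function.Periodic.norm_qParam_lt_one hM' hz
      simpa [Metric.mem_eball, edist_zero_right, enorm_eq_nnnorm] using! this
  refine this.congr fun z hz => ?_
  rw [Function.comp_apply, UpperHalfPlane.ofComplex_apply_of_im_pos hz, ← (h ⟨z, hz⟩).tsum_eq,
    FormalMultilinearSeries.sum]
  refine tsum_congr fun n => ?_
  rw [qq_eq]
  simp [hP, mul_comm]

/-- existence of expansions -/
lemma HE_of_periodic {M : ℕ} (hM : 0 < M) {F : ℍ → ℂ}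
    (hper : ∀ τ : ℍ, F ((M : ℝ) +ᵥ τ) = F τ) (hd : MDiff F) (hb : IsBoundedAtImInfty F) :
    HE M F (UpperHalfPlane.qExpansion (M : ℝ) F) := by
  intro τ
  have hp : Function.Periodic (F ∘ ofComplex) ((M : ℝ) : ℂ) := by
    intro z
    by_cases hz : 0 < z.im
    · have hz' : 0 < (z + ((M : ℝ) : ℂ)).im := by simpa using hz
      simp only [Function.comp_apply]
      rw [ofComplex_apply_of_im_pos hz, ofComplex_apply_of_im_pos hz', ← hper ⟨z, hz⟩]
      congr 1
      ext
      simp [add_comm]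
    · have hz' : ¬ 0 < (z + ((M : ℝ) : ℂ)).im := by simpa using hz
      simp only [Function.comp_apply]
      rw [ofComplex_apply_of_im_nonpos (not_lt.mp hz), ofComplex_apply_of_im_nonpos (not_lt.mp hz')]
  have := UpperHalfPlane.hasSum_qExpansion (h := (M : ℝ)) (by exact_mod_cast hM) hp hd hb τ
  rw [← qq_eq] at this
  exact this

section core
open Polynomial in
lemma lagr {A G : Type*} [CommRing A] [Fintype G] [DecidableEq G] (K b : G → A) (l : ℕ → A)
    (h : ∀ i, ∑ x, b x * K x ^ i = l i) (x : G) :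
    b x * ∏ y ∈ Finset.univ.erase x, (K x - K y) =
      ∑ i ∈ Finset.range (Fintype.card G),
        (∏ y ∈ Finset.univ.erase x, (Polynomial.X - Polynomial.C (K y))).coeff i * l i := by
  set P := ∏ y ∈ Finset.univ.erase x, (Polynomial.X - Polynomial.C (K y)) with hP
  have hdeg : P.natDegree < Fintype.card G := by
    have h1 : P.natDegree ≤ ∑ y ∈ Finset.univ.erase x, 1 := by
      refine (Polynomial.natDegree_prod_le _ _).trans (Finset.sum_le_sum fun y _ => ?_)
      exact Polynomial.natDegree_X_sub_C_le _
    have h2 : (Finset.univ.erase x).card < Fintype.card G := by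
      rw [← Finset.card_univ]
      exact Finset.card_erase_lt_of_mem (Finset.mem_univ x)
    simp only [Finset.sum_const, smul_eq_mul, mul_one] at h1
    omega
  have hev : ∀ a : A, P.eval a = ∑ i ∈ Finset.range (Fintype.card G), P.coeff i * a ^ i :=
    fun a => Polynomial.eval_eq_sum_range' hdeg a
  have hev' : ∀ z : G, P.eval (K z) = ∏ y ∈ Finset.univ.erase x, (K z - K y) := by
    intro z
    rw [hP, Polynomial.eval_prod]
    simp
  rw [← hev']
  calc b x * P.eval (K x) = ∑ z, b z * P.eval (K z) := by
        rw [Finset.sum_eq_single x]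
        · intro z _ hz
          rw [hev', Finset.prod_eq_zero (i := z)]
          · simp
          · simp [hz]
          · simp
        · simp
    _ = _ := by
        simp_rw [hev, ← h, Finset.mul_sum]
        rw [Finset.sum_comm]
        refine Finset.sum_congr rfl fun i _ => Finset.sum_congr rfl fun z _ => ?_
        ring

open Polynomial in
lemma scale_coeff {G : Type*} (s : Finset G) (a : G → ℂ) (u : ℂ) (i : ℕ) :
    u ^ i * (∏ y ∈ s, (Polynomial.X - Polynomial.C (u * a y))).coeff i =
      u ^ s.card * (∏ y ∈ s, (Polynomial.X - Polynomial.C (a y))).coeff i := by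
  have h1 : (∏ y ∈ s, (Polynomial.X - Polynomial.C (u * a y))).comp (Polynomial.C u * Polynomial.X)
      = Polynomial.C (u ^ s.card) * ∏ y ∈ s, (Polynomial.X - Polynomial.C (a y)) := by
    rw [Polynomial.prod_comp, Polynomial.C_pow, ← Finset.prod_const, ← Finset.prod_mul_distrib]
    refine Finset.prod_congr rfl fun y _ => ?_
    simp [mul_sub]
  have h2 := congr_arg (fun p => Polynomial.coeff p i) h1
  simp only [Polynomial.comp_C_mul_X_coeff, Polynomial.coeff_C_mul] at h2
  rw [← h2]; ring

variable {G : Type*} [Group G] [Fintype G] [DecidableEq G]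

/-- product of differences -/
def QQ {A : Type*} [CommRing A] (K : G → A) (x : G) : A := ∏ y ∈ Finset.univ.erase x, (K x - K y)

/-- Lagrange numerator -/
def RR {A : Type*} [CommRing A] (K : G → A) (l : ℕ → A) (x : G) : A :=
  ∑ i ∈ Finset.range (Fintype.card G),
        (∏ y ∈ Finset.univ.erase x, (Polynomial.X - Polynomial.C (K y))).coeff i * l i

lemma map_QQ {A B : Type*} [CommRing A] [CommRing B] (φ : A →+* B) (K : G → A) (x : G) :
    φ (QQ K x) = QQ (fun y => φ (K y)) x := by
  simp [QQ, map_prod]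

lemma map_RR {A B : Type*} [CommRing A] [CommRing B] (φ : A →+* B) (K : G → A) (l : ℕ → A) (x : G) :
    φ (RR K l x) = RR (fun y => φ (K y)) (fun i => φ (l i)) x := by
  simp only [RR, map_sum, map_mul]
  refine Finset.sum_congr rfl fun i _ => ?_
  rw [← Polynomial.coeff_map, Polynomial.map_prod]
  simp

lemma erase_image (x g : G) (f : G → ℂ) :
    ∏ y ∈ Finset.univ.erase x, f (y * g) = ∏ y ∈ Finset.univ.erase (x * g), f y := by
  refine Finset.prod_bij (fun y _ => y * g) ?_ ?_ ?_ ?_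
  · intro y hy; simpa using hy
  · intro y _ z _ h; simpa using h
  · intro y hy
    refine ⟨y * g⁻¹, ?_, by simp⟩
    simp only [Finset.mem_erase, ne_eq, Finset.mem_univ, and_true] at hy ⊢
    intro h; apply hy; rw [← h]; simp
  · intros; rfl

lemma erase_image' (x g : G) (f : G → Polynomial ℂ) :
    ∏ y ∈ Finset.univ.erase x, f (y * g) = ∏ y ∈ Finset.univ.erase (x * g), f y := by
  refine Finset.prod_bij (fun y _ => y * g) ?_ ?_ ?_ ?_
  · intro y hy; simpa using hy
  · intro y _ z _ h; simpa using h
  · intro y hy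
    refine ⟨y * g⁻¹, ?_, by simp⟩
    simp only [Finset.mem_erase, ne_eq, Finset.mem_univ, and_true] at hy ⊢
    intro h; apply hy; rw [← h]; simp
  · intros; rfl

lemma QQ_scale (K K' : G → ℂ) (u : ℂ) (g : G) (h : ∀ x, K x = u * K' (x * g)) (x : G) :
    QQ K x = u ^ (Fintype.card G - 1) * QQ K' (x * g) := by
  unfold QQ
  rw [← erase_image x g (fun y => K' (x * g) - K' y)]
  simp_rw [h, ← mul_sub, Finset.prod_mul_distrib, Finset.prod_const]
  rw [Finset.card_erase_of_mem (Finset.mem_univ x), Finset.card_univ]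

lemma RR_scale (K K' : G → ℂ) (u v : ℂ) (g : G) (h : ∀ x, K x = u * K' (x * g))
    (l l' : ℕ → ℂ) (hl : ∀ i, l i = v * u ^ i * l' i) (x : G) :
    RR K l x = v * u ^ (Fintype.card G - 1) * RR K' l' (x * g) := by
  unfold RR
  rw [Finset.mul_sum]
  refine Finset.sum_congr rfl fun i _ => ?_
  rw [← erase_image' x g (fun y => Polynomial.X - Polynomial.C (K' y))]
  have := scale_coeff (Finset.univ.erase x) (fun y => K' (y * g)) u i
  rw [Finset.card_erase_of_mem (Finset.mem_univ x), Finset.card_univ] at this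
  simp_rw [h, hl]
  linear_combination v * l' i * this

/-- Main algebraic step. -/
lemma core {M : ℕ} (K : G → ℍ → ℂ) (Kp : G → ℂ⟦X⟧) (hK : ∀ x, HE M (K x) (Kp x))
    (hinj : Function.Injective Kp) (ψ : SL(2, ℤ) → G) (k : ℤ)
    (hKγ : ∀ x (γ : SL(2, ℤ)) (τ : ℍ), K x (γ • τ) = denom γ τ ^ 3 * K (x * ψ γ) τ)
    (b : G → ℂ⟦X⟧) (l : ℕ → ℍ → ℂ) (lp : ℕ → ℂ⟦X⟧) (hl : ∀ i, HE M (l i) (lp i))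
    (hb : ∀ i, ∑ x, b x * Kp x ^ i = lp i)
    (hlγ : ∀ i (γ : SL(2, ℤ)) (τ : ℍ), l i (γ • τ) = denom γ τ ^ k * (denom γ τ ^ 3) ^ i * l i τ)
    (F : ℍ → ℂ) (hF : HE M F (b 1)) (hM : 0 < M) :
    ∃ (Q R : G → ℍ → ℂ) (Qp Rp : G → ℂ⟦X⟧), (∀ x, HE M (Q x) (Qp x)) ∧ (∀ x, HE M (R x) (Rp x)) ∧
      (∀ x, Qp x ≠ 0) ∧ (∀ x, b x * Qp x = Rp x) ∧
      ∀ (γ : SL(2, ℤ)) (τ : ℍ), F (γ • τ) * Q (ψ γ) τ = denom γ τ ^ k * R (ψ γ) τ := by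
  let Ks : G → SR M := fun x => ⟨(K x, Kp x), hK x⟩
  let ls : ℕ → SR M := fun i => ⟨(l i, lp i), hl i⟩
  let φ1 : SR M →+* (ℍ → ℂ) := (RingHom.fst _ _).comp (SR M).subtype
  let φ2 : SR M →+* ℂ⟦X⟧ := (RingHom.snd _ _).comp (SR M).subtype
  have hφ1K : ∀ x, φ1 (Ks x) = K x := fun x => rfl
  have hφ2K : ∀ x, φ2 (Ks x) = Kp x := fun x => rfl
  have hφ1l : ∀ x, φ1 (ls x) = l x := fun x => rfl
  have hφ2l : ∀ x, φ2 (ls x) = lp x := fun x => rfl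
  have hQe : ∀ x τ, φ1 (QQ Ks x) τ = QQ (fun y => K y τ) x := by
    intro x τ
    have := map_QQ ((Pi.evalRingHom (fun _ : ℍ => ℂ) τ).comp φ1) Ks x
    exact this
  have hRe : ∀ x τ, φ1 (RR Ks ls x) τ = RR (fun y => K y τ) (fun i => l i τ) x := by
    intro x τ
    have := map_RR ((Pi.evalRingHom (fun _ : ℍ => ℂ) τ).comp φ1) Ks ls x
    exact this
  have hb' : ∀ x, b x * φ2 (QQ Ks x) = φ2 (RR Ks ls x) := by
    intro x
    rw [map_QQ, map_RR]
    exact lagr Kp b lp hb x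
  have hHE : ∀ s : SR M, HE M (φ1 s) (φ2 s) := fun s => s.2
  refine ⟨fun x => φ1 (QQ Ks x), fun x => φ1 (RR Ks ls x), fun x => φ2 (QQ Ks x),
    fun x => φ2 (RR Ks ls x), fun x => hHE _, fun x => hHE _, ?_, hb', ?_⟩
  · intro x
    simp only [map_QQ]
    unfold QQ
    rw [Finset.prod_ne_zero_iff]
    intro y hy
    rw [sub_ne_zero]
    intro h
    exact (Finset.ne_of_mem_erase hy) (hinj h).symm
  · intro γ τ
    have h1 : F * φ1 (QQ Ks 1) = φ1 (RR Ks ls 1) := by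
      have := hF.mul (hHE (QQ Ks 1))
      rw [hb' 1] at this
      exact this.fun_unique (hHE _)
    have h2 := congr_fun h1 (γ • τ)
    have hd : denom γ τ ≠ 0 := denom_ne_zero _ _
    simp only [Pi.mul_apply, hQe, hRe] at h2 ⊢
    rw [QQ_scale _ (fun y => K y τ) (denom γ τ ^ 3) (ψ γ) (fun x => hKγ x γ τ),
      RR_scale _ (fun y => K y τ) (denom γ τ ^ 3) (denom γ τ ^ k) (ψ γ)
        (fun x => hKγ x γ τ) _ (fun i => l i τ) (fun i => hlγ i γ τ), one_mul] at h2
    have h3 : (denom γ τ ^ 3) ^ (Fintype.card G - 1) ≠ 0 := pow_ne_zero _ (pow_ne_zero _ hd)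
    apply mul_left_cancel₀ h3
    linear_combination h2

end core

section levelone

/-- substitute X ↦ X^d -/
def stretch (d : ℕ) (p : ℂ⟦X⟧) : ℂ⟦X⟧ := PowerSeries.mk fun n => if d ∣ n then coeff (n / d) p else 0

lemma coeff_stretch {d : ℕ} (hd : 0 < d) (p : ℂ⟦X⟧) (n : ℕ) : coeff (d * n) (stretch d p) = coeff n p := by
  simp [stretch, Nat.mul_div_cancel_left n hd]

lemma map_stretch (d : ℕ) (p : ℂ⟦X⟧) (σ : ℂ →+* ℂ) :
    PowerSeries.map σ (stretch d p) = stretch d (PowerSeries.map σ p) := by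
  ext n
  simp only [stretch, coeff_map, coeff_mk]
  split_ifs <;> simp

lemma stretch_C (d : ℕ) (hd : 0 < d) (a : ℂ) : stretch d (C a) = C a := by
  ext n
  simp only [stretch, coeff_mk, coeff_C]
  by_cases hn : n = 0
  · simp [hn]
  · simp only [hn, if_false]
    split_ifs with h1 h2
    · exact absurd (Nat.eq_zero_of_dvd_of_div_eq_zero h1 h2) hn
    · rfl
    · rfl

lemma stretch_add (d : ℕ) (p q : ℂ⟦X⟧) : stretch d (p + q) = stretch d p + stretch d q := by
  ext n
  simp only [stretch, coeff_mk, map_add]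
  split_ifs <;> simp

lemma HE.stretch {N d : ℕ} (hN : 0 < N) (hd : 0 < d) {F p} (h : HE N F p) :
    HE (d * N) F (stretch d p) := by
  intro τ
  have h1 : qq (d * N) τ ^ d = qq N τ := by
    rw [qq, qq, ← Complex.exp_nat_mul]
    congr 1
    have : (d : ℂ) ≠ 0 := by exact_mod_cast hd.ne'
    have : (N : ℂ) ≠ 0 := by exact_mod_cast hN.ne'
    push_cast
    field_simp
  have hinj : Function.Injective (fun n : ℕ => d * n) := fun a b hab => Nat.eq_of_mul_eq_mul_left hd hab
  rw [← hinj.hasSum_iff]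
  · refine HasSum.congr_fun' (h τ) fun n => ?_
    simp only [Function.comp_apply]
    rw [coeff_stretch hd, pow_mul, h1]
  · intro n hn
    have : ¬ d ∣ n := by
      rintro ⟨m, rfl⟩
      exact hn ⟨m, rfl⟩
    simp [S8.stretch, this]

variable (σ : ℂ ≃+* ℂ)

lemma map_E {k : ℕ} (hk : 3 ≤ k) (hk2 : Even k) :
    PowerSeries.map (σ : ℂ →+* ℂ) (UpperHalfPlane.qExpansion 1 (ModularForm.E hk)) =
      UpperHalfPlane.qExpansion 1 (ModularForm.E hk) := by
  ext m
  rw [coeff_map, EisensteinSeries.E_qExpansion_coeff hk hk2]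
  have h2 : σ 2 = 2 := map_ofNat σ 2
  split_ifs <;> simp [h2]

lemma map_disc :
    PowerSeries.map (σ : ℂ →+* ℂ) (UpperHalfPlane.qExpansion 1 ModularForm.discriminant) =
      UpperHalfPlane.qExpansion 1 ModularForm.discriminant := by
  have h4 := map_E σ (k := 4) (by norm_num) ⟨2, rfl⟩
  have h6 := map_E σ (k := 6) (by norm_num) ⟨3, rfl⟩
  have hE4 : HE 1 (ModularForm.E₄) (UpperHalfPlane.qExpansion 1 ModularForm.E₄) := fun τ => by
    rw [qq_eq]; push_cast
    exact ModularForm.hasSum_qExpansion _ one_pos one_mem_strictPeriods_SL τ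
  have hE6 : HE 1 (ModularForm.E₆) (UpperHalfPlane.qExpansion 1 ModularForm.E₆) := fun τ => by
    rw [qq_eq]; push_cast
    exact ModularForm.hasSum_qExpansion _ one_pos one_mem_strictPeriods_SL τ
  have hD : HE 1 (ModularForm.discriminant) (UpperHalfPlane.qExpansion 1 ModularForm.discriminant) := fun τ => by
    rw [qq_eq]; push_cast
    exact ModularForm.hasSum_qExpansion CuspForm.discriminant one_pos one_mem_strictPeriods_SL τ
  have hD' := ((((hE4.mul hE4).mul hE4).add (hE6.mul hE6).neg).mul (HE.const 1 (1 / 1728)))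
  have : ModularForm.discriminant = ((⇑ModularForm.E₄ * ⇑ModularForm.E₄ * ⇑ModularForm.E₄ +
      -(⇑ModularForm.E₆ * ⇑ModularForm.E₆)) * fun _ => (1 / 1728 : ℂ)) := by
    funext z
    rw [ModularForm.discriminant_eq_E₄_cube_sub_E₆_sq]
    simp only [Pi.mul_apply, Pi.add_apply, Pi.neg_apply]
    ring
  rw [← this] at hD'
  rw [hD.unique one_pos hD']
  have hC : PowerSeries.map (σ : ℂ →+* ℂ) (C (1 / 1728 : ℂ)) = C (1 / 1728 : ℂ) := by
    have h2 : σ 1728 = 1728 := map_ofNat σ 1728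
    rw [PowerSeries.map_C]; simp [h2]
  simp only [map_mul, map_add, map_neg, hC]
  rw [h4, h6]

lemma HE_one {k : ℤ} (F : ModularForm 𝒮ℒ k) : HE 1 F (UpperHalfPlane.qExpansion 1 F) := fun τ => by
  rw [qq_eq]; push_cast
  exact ModularForm.hasSum_qExpansion _ one_pos one_mem_strictPeriods_SL τ

lemma levelone (n : ℕ) : ∀ (k : ℤ), k < n → ∀ F : ModularForm 𝒮ℒ k, ∃ F' : ModularForm 𝒮ℒ k,
    UpperHalfPlane.qExpansion 1 F' = PowerSeries.map (σ : ℂ →+* ℂ) (UpperHalfPlane.qExpansion 1 F) := by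
  have hz : ∀ (k : ℤ) (F : ModularForm 𝒮ℒ k), F = 0 → ∃ F' : ModularForm 𝒮ℒ k,
    UpperHalfPlane.qExpansion 1 F' = PowerSeries.map (σ : ℂ →+* ℂ) (UpperHalfPlane.qExpansion 1 F) := by
    rintro k F rfl
    refine ⟨0, ?_⟩
    have : UpperHalfPlane.qExpansion 1 (⇑(0 : ModularForm 𝒮ℒ k)) = 0 := UpperHalfPlane.qExpansion_zero 1
    rw [this, map_zero]
  induction n with
  | zero =>
    intro k hk F
    apply hz
    have := ModularFormClass.levelOne_neg_weight_eq_zero (by simpa using hk) F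
    exact DFunLike.coe_injective this
  | succ n ih =>
    intro k hk F
    rcases Int.even_or_odd k with he | ho
    swap
    · exact hz k F (ModularForm.levelOne_odd_weight_eq_zero ho F)
    rcases lt_or_ge k 0 with hneg | hnn
    · exact ih k (by omega) F
    lift k to ℕ using hnn
    have he' : Even k := by exact_mod_cast he
    rcases lt_or_ge k 3 with hlt | hk3
    · have : k = 0 ∨ k = 2 := by
        rcases he' with ⟨r, hr⟩; omega
      rcases this with rfl | rfl
      · obtain ⟨c, hc⟩ := ModularFormClass.levelOne_weight_zero_const F
        refine ⟨ModularForm.const (σ c), ?_⟩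
        have h1 : UpperHalfPlane.qExpansion 1 F = C c := by
          refine (HE_one F).unique one_pos ?_
          rw [hc]
          exact HE.const 1 c
        rw [h1, PowerSeries.map_C]
        refine (HE_one (ModularForm.const (σ c))).unique one_pos ?_
        exact HE.const 1 (σ c)
      · apply hz
        have := ModularForm.levelOne_weight_two_rank_zero
        have := rank_zero_iff.mp this
        exact Subsingleton.elim _ _
    · set a0 := (UpperHalfPlane.qExpansion 1 F).coeff 0 with ha0
      set F1 : ModularForm 𝒮ℒ k := F - a0 • ModularForm.E hk3 with hF1
      have hq1 : UpperHalfPlane.qExpansion 1 F1 = UpperHalfPlane.qExpansion 1 F -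
          a0 • UpperHalfPlane.qExpansion 1 (ModularForm.E hk3) := by
        rw [hF1, FunLike.coe_sub, ModularForm.qExpansion_sub,
          FunLike.coe_smul, ModularForm.qExpansion_smul]
        all_goals simp
      have hc : (UpperHalfPlane.qExpansion 1 F1).coeff 0 = 0 := by
        rw [hq1, map_sub, PowerSeries.coeff_smul, EisensteinSeries.E_qExpansion_coeff_zero hk3 he']
        simp [ha0]
      have hq2 := ModularForm.qExpansion_eq_qExpansion_discriminant_mul F1 hc
      set F2 := CuspForm.discriminantEquiv (ModularForm.toCuspForm F1 hc)
      obtain ⟨F2', hF2'⟩ := ih (k - 12) (by push_cast at hk; omega) F2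
      let D : ModularForm 𝒮ℒ k := ModularForm.mcast (by ring) (ModularForm.mul (k_1 := 12) CuspForm.discriminant F2')
      refine ⟨σ a0 • ModularForm.E hk3 + D, ?_⟩
      have hD : HE 1 D (UpperHalfPlane.qExpansion 1 ModularForm.discriminant * UpperHalfPlane.qExpansion 1 F2') := by
        have h1 : HE 1 (ModularForm.discriminant) (UpperHalfPlane.qExpansion 1 ModularForm.discriminant) := fun τ => by
          rw [qq_eq]; push_cast
          exact ModularForm.hasSum_qExpansion CuspForm.discriminant one_pos one_mem_strictPeriods_SL τ
        exact h1.mul (HE_one F2')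
      have hE : HE 1 (⇑(σ a0 • ModularForm.E hk3)) (C (σ a0) * UpperHalfPlane.qExpansion 1 (ModularForm.E hk3)) :=
        (HE.const 1 (σ a0)).mul (HE_one _)
      refine (HE_one _).unique one_pos (q := _) ?_
      have h3 : UpperHalfPlane.qExpansion 1 F = C a0 * UpperHalfPlane.qExpansion 1 (ModularForm.E hk3) +
          UpperHalfPlane.qExpansion 1 ModularForm.discriminant * UpperHalfPlane.qExpansion 1 F2 := by
        rw [← hq2, hq1, PowerSeries.smul_eq_C_mul]; ring
      rw [h3, map_add, map_mul, map_mul, map_E σ hk3 he', map_disc, PowerSeries.map_C, ← hF2']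
      exact hE.add hD

end levelone


section eis

variable {M : ℕ} [NeZero M]

/-- standard additive character -/
abbrev ee : AddChar (ZMod M) ℂ := ZMod.stdAddChar

/-- normalising constant -/
def kap (M : ℕ) : ℂ := (-2 * π * Complex.I) ^ 3 / (2 * (M : ℂ) ^ 3)

lemma kap_ne (M : ℕ) [NeZero M] : kap M ≠ 0 := by
  have : (M : ℂ) ≠ 0 := by exact_mod_cast NeZero.ne M
  have h2 : (π : ℂ) ≠ 0 := by exact_mod_cast Real.pi_ne_zero
  simp [kap, this, h2, Complex.I_ne_zero]

/-- constant term -/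
def cst (b : ZMod M) : ℂ := (M : ℂ) ^ 2 / 3 *
  ∑ r : ZMod M, ee (-(r * b)) * (((Polynomial.bernoulli 3).eval ((r.val : ℚ) / (M : ℚ)) : ℚ) : ℂ)

lemma ee_fourier (r : ZMod M) (d : ℤ) :
    (ee (r * (d : ZMod M)) : ℂ) = fourier d (((r.val : ℝ) / M : ℝ) : UnitAddCircle) := by
  have h1 : r * (d : ZMod M) = (((r.val : ℤ) * d : ℤ) : ZMod M) := by
    push_cast
    rw [ZMod.natCast_zmod_val]
  rw [h1, ZMod.stdAddChar_coe, fourier_coe_apply]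
  congr 1
  push_cast
  ring

lemma cst_hasSum (b : ZMod M) :
    HasSum (fun d : ℤ => if (d : ZMod M) = b then 1 / (d : ℂ) ^ 3 else 0) (kap M * cst b) := by
  have hM0 : (M : ℂ) ≠ 0 := by exact_mod_cast NeZero.ne M
  have hMpos : (0 : ℝ) < M := by exact_mod_cast NeZero.pos M
  have key : ∀ r : ZMod M, HasSum (fun d : ℤ => (1 / (M : ℂ)) * ee (-(r * b)) *
      (1 / (d : ℂ) ^ 3 * ee (r * (d : ZMod M))))
      ((1 / (M : ℂ)) * ee (-(r * b)) * (-(2 * π * Complex.I) ^ 3 / 6 *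
        (((Polynomial.bernoulli 3).eval ((r.val : ℚ) / (M : ℚ)) : ℚ) : ℂ))) := by
    intro r
    refine HasSum.mul_left _ ?_
    have hx : ((r.val : ℝ) / M : ℝ) ∈ Set.Icc (0 : ℝ) 1 := by
      constructor
      · positivity
      · rw [div_le_one hMpos]
        exact_mod_cast (ZMod.val_lt r).le
    have := hasSum_one_div_pow_mul_fourier_mul_bernoulliFun (k := 3) (by norm_num) hx
    have h6 : ((Nat.factorial 3 : ℕ) : ℂ) = 6 := by norm_num [Nat.factorial]
    rw [h6] at this
    have h7 : ((bernoulliFun 3 ((r.val : ℝ) / M) : ℝ) : ℂ) =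
        (((Polynomial.bernoulli 3).eval ((r.val : ℚ) / (M : ℚ)) : ℚ) : ℂ) := by
      have h2 : ((r.val : ℝ) / M : ℝ) = algebraMap ℚ ℝ ((r.val : ℚ) / (M : ℚ)) := by
        rw [map_div₀, map_natCast, map_natCast]
      rw [bernoulliFun, h2, Polynomial.eval_map, Polynomial.eval₂_at_apply]
      simp
    rw [h7] at this
    simp_rw [ee_fourier]
    exact this
  have := hasSum_sum (s := Finset.univ) fun r _ => key r
  convert this using 1
  · funext d
    have h3 : ∀ r : ZMod M, (1 / (M : ℂ)) * ee (-(r * b)) * (1 / (d : ℂ) ^ 3 * ee (r * (d : ZMod M))) =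
        (1 / (M : ℂ)) * (1 / (d : ℂ) ^ 3) * ee (r * ((d : ZMod M) - b)) := by
      intro r
      rw [mul_sub, sub_eq_add_neg, AddChar.map_add_eq_mul]
      ring
    simp_rw [h3]
    rw [← Finset.mul_sum, AddChar.sum_mulShift _ (ZMod.isPrimitive_stdAddChar M), ZMod.card]
    simp only [sub_eq_zero]
    split_ifs
    · field_simp
    · simp
  · rw [kap, cst, Finset.mul_sum, Finset.mul_sum]
    refine Finset.sum_congr rfl fun r _ => ?_
    field_simp
    ring

lemma row_tsum (c : ℕ+) (b : ZMod M) (τ : ℍ) :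
    ∑' d : ℤ, (if (d : ZMod M) = b then ((c : ℂ) * τ + d) ^ (-3 : ℤ) else 0) =
      kap M * ∑' m : ℕ+, (m : ℂ) ^ 2 * ee (((m : ℕ) : ZMod M) * b) * qq M τ ^ (c * m : ℕ) := by
  have hM0 : (M : ℂ) ≠ 0 := by exact_mod_cast NeZero.ne M
  have hMr : (M : ℝ) ≠ 0 := by exact_mod_cast NeZero.ne M
  have hMpos : (0 : ℝ) < M := by exact_mod_cast NeZero.pos M
  have hinj : Function.Injective (fun e : ℤ => (b.val : ℤ) + M * e) := by
    intro x y h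
    have : (M : ℤ) ≠ 0 := by exact_mod_cast NeZero.ne M
    have h' : (M : ℤ) * x = M * y := by simpa only [add_right_inj] using h
    exact mul_left_cancel₀ this h'
  rw [← hinj.tsum_eq]
  swap
  · intro d hd
    simp only [Function.mem_support, ne_eq, ite_eq_right_iff, not_forall] at hd
    obtain ⟨h1, -⟩ := hd
    have : ((b.val : ℤ) : ZMod M) = d := by rw [h1]; simp
    rw [ZMod.intCast_eq_intCast_iff_dvd_sub] at this
    obtain ⟨e, he⟩ := this
    exact ⟨e, by simp only; omega⟩
  have hz : 0 < (((c : ℂ) * τ + b.val) / M : ℂ).im := by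
    have h1 : (((c : ℂ) * τ + b.val) / M : ℂ) = (((c : ℝ) / M : ℝ) : ℂ) * τ + ((b.val / M : ℝ) : ℂ) := by
      push_cast; field_simp
    rw [h1, Complex.add_im, Complex.im_ofReal_mul, Complex.ofReal_im, add_zero]
    have := τ.im_pos
    have hc : (0 : ℝ) < c := by exact_mod_cast c.pos
    exact mul_pos (div_pos hc hMpos) this
  have key := EisensteinSeries.qExpansion_identity_pnat (k := 2) (by norm_num) ⟨_, hz⟩
  have h1 : ∀ e : ℤ, (if (((b.val : ℤ) + M * e : ℤ) : ZMod M) = b then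
      ((c : ℂ) * τ + (((b.val : ℤ) + M * e : ℤ) : ℂ)) ^ (-3 : ℤ) else 0) =
      (M : ℂ)⁻¹ ^ 3 * (1 / (((c : ℂ) * τ + b.val) / M + e) ^ (2 + 1)) := by
    intro e
    rw [if_pos (by simp)]
    have h3 : (c : ℂ) * τ + (((b.val : ℤ) + M * e : ℤ) : ℂ) = M * (((c : ℂ) * τ + b.val) / M + e) := by
      push_cast
      field_simp
      ring
    rw [h3, zpow_neg, mul_zpow, mul_inv, one_div, inv_pow]
    rfl
  simp_rw [h1, tsum_mul_left]
  simp only at key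
  rw [key, ← mul_assoc]
  congr 1
  · rw [kap]; simp [Nat.factorial]; field_simp
  · refine tsum_congr fun m => ?_
    rw [mul_assoc ((m : ℂ) ^ 2)]
    congr 1
    have h2 : ((m : ℕ) : ZMod M) * b = (((m : ℕ) * (b.val : ℤ) : ℤ) : ZMod M) := by
      push_cast
      rw [ZMod.natCast_zmod_val]
    rw [h2, ZMod.stdAddChar_coe, qq, ← Complex.exp_nat_mul, ← Complex.exp_nat_mul, ← Complex.exp_add]
    congr 1
    push_cast
    field_simp
    ring

lemma lambert (u : ℕ → ℕ → ℂ) (hu : ∀ c m, ‖u c m‖ ≤ 1) {q : ℂ} (hq : ‖q‖ < 1) :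
    HasSum (fun n : ℕ => (∑ x ∈ n.divisorsAntidiagonal, (x.2 : ℂ) ^ 2 * u x.1 x.2) * q ^ n)
      (∑' c : ℕ+, ∑' m : ℕ+, (m : ℂ) ^ 2 * u c m * q ^ (c * m : ℕ)) := by
  have hs : Summable fun c : ℕ+ × ℕ+ => (c.2 : ℂ) ^ 2 * u c.1 c.2 * q ^ (c.1 * c.2 : ℕ) := by
    refine Summable.of_norm_bounded (summable_prod_mul_pow 2 hq).norm fun c => ?_
    rw [norm_mul, norm_mul, norm_mul]
    have := hu c.1 c.2
    gcongr
    exact mul_le_of_le_one_right (norm_nonneg _) this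
  rw [← hs.tsum_prod]
  have h1 := hs.hasSum
  rw [← sigmaAntidiagonalEquivProd.hasSum_iff] at h1
  have h2 := h1.sigma (fun n => hasSum_fintype _)
  have h3 : HasSum (fun n : ℕ+ => (∑ x ∈ (n : ℕ).divisorsAntidiagonal, (x.2 : ℂ) ^ 2 * u x.1 x.2) * q ^ (n : ℕ))
      (∑' c : ℕ+ × ℕ+, (c.2 : ℂ) ^ 2 * u c.1 c.2 * q ^ (c.1 * c.2 : ℕ)) := by
    convert h2 using 2 with n
    rw [← Finset.sum_attach, Finset.sum_mul, Finset.univ_eq_attach]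
    refine Finset.sum_congr rfl fun x _ => ?_
    have := (Nat.mem_divisorsAntidiagonal.mp x.2).1
    simp only [Function.comp_apply, sigmaAntidiagonalEquivProd, divisorsAntidiagonalFactors,
      Equiv.coe_fn_mk, PNat.mk_coe]
    exact congr_arg _ (congr_arg _ this.symm)
  rw [hasSum_pnat_iff (f := fun n : ℕ => (∑ x ∈ n.divisorsAntidiagonal, (x.2 : ℂ) ^ 2 * u x.1 x.2) * q ^ n)] at h3
  simpa using h3

/-- reduction mod M -/
abbrev redM (M : ℕ) : SL(2, ℤ) →* SL(2, ZMod M) := Matrix.SpecialLinearGroup.map (Int.castRingHom (ZMod M))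

/-- Eisenstein series of weight 3 -/
def Gv (v : Fin 2 → ZMod M) (τ : ℍ) : ℂ :=
  (kap M)⁻¹ * ∑' x : Fin 2 → ℤ, if (fun i => (x i : ZMod M)) = v then EisensteinSeries.eisSummand 3 x τ else 0

open Matrix in
lemma Gv_smul (v : Fin 2 → ZMod M) (γ : SL(2, ℤ)) (τ : ℍ) :
    Gv v (γ • τ) = denom γ τ ^ 3 * Gv (v ᵥ* (redM M γ).1) τ := by
  let e : (Fin 2 → ℤ) ≃ (Fin 2 → ℤ) :=
    { toFun := fun x => x ᵥ* γ.1
      invFun := fun x => x ᵥ* (γ⁻¹).1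
      left_inv := fun x => by
        simp only [Matrix.vecMul_vecMul]
        rw [← Matrix.SpecialLinearGroup.coe_mul, mul_inv_cancel]; simp
      right_inv := fun x => by
        simp only [Matrix.vecMul_vecMul]
        rw [← Matrix.SpecialLinearGroup.coe_mul, inv_mul_cancel]; simp }
  unfold Gv
  rw [mul_left_comm]
  congr 1
  rw [← e.tsum_eq (fun x => if (fun i => (x i : ZMod M)) = v ᵥ* (redM M γ).1 then EisensteinSeries.eisSummand 3 x τ else 0),
    ← tsum_mul_left]
  refine tsum_congr fun x => ?_
  have h1 : (fun i => ((e x i : ℤ) : ZMod M)) = (fun i => (x i : ZMod M)) ᵥ* (redM M γ).1 := by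
    have := (Int.castRingHom (ZMod M)).map_vecMul γ.1 x
    funext i
    exact this i
  have h2 : ((fun i => ((e x i : ℤ) : ZMod M)) = v ᵥ* (redM M γ).1) ↔ ((fun i => (x i : ZMod M)) = v) := by
    rw [h1]
    constructor
    · intro h
      have := congr_arg (fun y => y ᵥ* ((redM M γ)⁻¹).1) h
      simp only [Matrix.vecMul_vecMul] at this
      rw [← Matrix.SpecialLinearGroup.coe_mul, mul_inv_cancel] at this
      simpa using this
    · rintro rfl; rfl
  by_cases h : (fun i => (x i : ZMod M)) = v
  · rw [if_pos h, if_pos (h2.mpr h), EisensteinSeries.eisSummand_SL2_apply]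
    rfl
  · rw [if_neg h, if_neg (fun h' => h (h2.mp h')), mul_zero]

/-- coefficient weights -/
def uu (v : Fin 2 → ZMod M) (c m : ℕ) : ℂ := if (c : ZMod M) = v 0 then ee ((m : ZMod M) * v 1) else 0

lemma uu_le (v : Fin 2 → ZMod M) (c m : ℕ) : ‖uu v c m‖ ≤ 1 := by
  unfold uu
  split_ifs
  · rw [ZMod.stdAddChar_apply, Circle.norm_coe]
  · simp

/-- expansion of Gv -/
def Gp (v : Fin 2 → ZMod M) : ℂ⟦X⟧ := C (if v 0 = 0 then cst (v 1) else 0) +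
  PowerSeries.mk (fun n => ∑ x ∈ n.divisorsAntidiagonal, (x.2 : ℂ) ^ 2 * uu v x.1 x.2) -
  PowerSeries.mk (fun n => ∑ x ∈ n.divisorsAntidiagonal, (x.2 : ℂ) ^ 2 * uu (-v) x.1 x.2)

lemma row_tsum' (v : Fin 2 → ZMod M) (c : ℕ+) (τ : ℍ) :
    ∑' d : ℤ, (if ((c : ℕ) : ZMod M) = v 0 ∧ (d : ZMod M) = v 1 then ((c : ℂ) * τ + d) ^ (-3 : ℤ) else 0) =
      kap M * ∑' m : ℕ+, (m : ℂ) ^ 2 * uu v c m * qq M τ ^ (c * m : ℕ) := by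
  by_cases h : ((c : ℕ) : ZMod M) = v 0
  · simp only [h, true_and, uu, if_true]
    exact row_tsum c (v 1) τ
  · simp [h, uu]

lemma Gv_HE (v : Fin 2 → ZMod M) : HE M (Gv v) (Gp v) := by
  intro τ
  have hq := norm_qq_lt M (NeZero.pos M) τ
  have l1 := lambert (uu v) (uu_le v) hq
  have l2 := lambert (uu (-v)) (uu_le (-v)) hq
  have l0 := HE.const M (if v 0 = 0 then cst (v 1) else 0) τ
  have h := ((l0.add l1).sub l2)
  have hval : Gv v τ = (if v 0 = 0 then cst (v 1) else 0) +
      (∑' c : ℕ+, ∑' m : ℕ+, (m : ℂ) ^ 2 * uu v c m * qq M τ ^ (c * m : ℕ)) -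
      (∑' c : ℕ+, ∑' m : ℕ+, (m : ℂ) ^ 2 * uu (-v) c m * qq M τ ^ (c * m : ℕ)) := by
    unfold Gv
    rw [inv_mul_eq_iff_eq_mul₀ (kap_ne M), ← (finTwoArrowEquiv ℤ).symm.tsum_eq]
    have hs : Summable fun x : ℤ × ℤ => if (fun i => (((finTwoArrowEquiv ℤ).symm x i : ℤ) : ZMod M)) = v
        then EisensteinSeries.eisSummand 3 ((finTwoArrowEquiv ℤ).symm x) τ else 0 := by
      refine Summable.of_norm_bounded (summable_prod_eisSummand (k := 3) le_rfl τ).norm fun x => ?_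
      split_ifs
      · exact le_rfl
      · simp
    rw [hs.tsum_prod]
    have h1 : ∀ c d : ℤ, (if (fun i => (((finTwoArrowEquiv ℤ).symm (c, d) i : ℤ) : ZMod M)) = v
        then EisensteinSeries.eisSummand 3 ((finTwoArrowEquiv ℤ).symm (c, d)) τ else 0) =
        if (c : ZMod M) = v 0 ∧ (d : ZMod M) = v 1 then ((c : ℂ) * τ + d) ^ (-3 : ℤ) else 0 := by
      intro c d
      have : ((fun i => (((finTwoArrowEquiv ℤ).symm (c, d) i : ℤ) : ZMod M)) = v) ↔
          ((c : ZMod M) = v 0 ∧ (d : ZMod M) = v 1) := by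
        rw [funext_iff, Fin.forall_fin_two]
        simp [finTwoArrowEquiv]
      simp only [this]
      simp [EisensteinSeries.eisSummand, finTwoArrowEquiv]
    have hs2 := hs.prod
    simp_rw [h1] at hs2 ⊢
    rw [tsum_int_eq_zero_add_tsum_pnat hs2, mul_sub, mul_add, sub_eq_add_neg]
    congr 1
    · congr 1
      · by_cases h0 : v 0 = 0
        · have := (cst_hasSum (v 1)).tsum_eq
          simp only [h0, if_true]
          rw [← this]
          refine tsum_congr fun d => ?_
          simp [zpow_neg]
        · have h0' : ¬ (0 = v 0) := fun h => h0 h.symm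
          simp [h0, h0']
      · rw [← tsum_mul_left]
        refine tsum_congr fun c => ?_
        rw [← row_tsum']
        norm_cast
    · rw [← tsum_mul_left, ← tsum_neg]
      refine tsum_congr fun c => ?_
      rw [← row_tsum', ← tsum_neg, ← tsum_comp_neg]
      refine tsum_congr fun d => ?_
      have e1 : (((-(c : ℤ) : ℤ) : ZMod M) = v 0 ∧ ((-d : ℤ) : ZMod M) = v 1) ↔
          (((c : ℕ) : ZMod M) = (-v) 0 ∧ (d : ZMod M) = (-v) 1) := by
        push_cast
        simp only [Pi.neg_apply, neg_eq_iff_eq_neg]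
      simp only [e1]
      split_ifs
      · have : (((-(c : ℤ) : ℤ) : ℂ) * τ + ((-d : ℤ) : ℂ)) = - ((c : ℂ) * τ + d) := by
          push_cast; ring
        rw [this, Odd.neg_zpow (by decide)]
      · simp
  rw [hval]
  refine HasSum.congr_fun' h fun n => ?_
  simp only [Gp, map_sub, map_add, coeff_mk]
  ring

end eis

section surj

lemma exists_coprime_lift {M : ℕ} (hM : 0 < M) (c d : ℤ) (hc : c ≠ 0)
    (h : ∃ u v w : ℤ, u * c + v * d + w * M = 1) : ∃ d' : ℤ, (M : ℤ) ∣ d' - d ∧ IsCoprime c d' := by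
  obtain ⟨u, v, w, huvw⟩ := h
  have hg0 : 0 < Int.gcd d M := Int.gcd_pos_of_ne_zero_right _ (by exact_mod_cast hM.ne')
  set g : ℤ := ((Int.gcd d M : ℕ) : ℤ) with hg
  have hgpos : 0 < g := Int.natCast_pos.mpr hg0
  obtain ⟨d1, hd1⟩ : g ∣ d := Int.gcd_dvd_left ..
  obtain ⟨m1, hm1⟩ : g ∣ (M : ℤ) := Int.gcd_dvd_right ..
  have hm1pos : 0 < m1 := by
    have : 0 < g * m1 := by rw [← hm1]; exact_mod_cast hM
    exact pos_of_mul_pos_right this hgpos.le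
  have hcop : IsCoprime d1 m1 := by
    have := Int.gcd_eq_gcd_ab d M
    rw [← hg] at this
    refine ⟨d.gcdA M, d.gcdB M, ?_⟩
    have h2 : g * (d.gcdA M * d1 + d.gcdB M * m1) = g * 1 := by
      rw [mul_one]
      conv_rhs => rw [this]
      linear_combination (-d.gcdA M) * hd1 + (- d.gcdB M) * hm1
    exact mul_left_cancel₀ hgpos.ne' h2
  lift m1 to ℕ using hm1pos.le
  have : NeZero m1 := ⟨by intro h; simp [h] at hm1pos⟩
  have hu : IsUnit ((d1 : ℤ) : ZMod m1) := by
    rw [ZMod.coe_int_isUnit_iff_isCoprime]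
    exact hcop.symm
  obtain ⟨p, hpgt, hp, hpm⟩ := Nat.forall_exists_prime_gt_and_eq_mod hu c.natAbs
  refine ⟨g * p, ?_, ?_⟩
  · have : ((p : ℤ) : ZMod m1) = (d1 : ZMod m1) := by exact_mod_cast hpm
    rw [ZMod.intCast_eq_intCast_iff_dvd_sub] at this
    obtain ⟨e, he⟩ := this
    refine ⟨-e, ?_⟩
    rw [hd1, hm1]
    linear_combination (-g) * he
  · refine IsCoprime.mul_right ?_ ?_
    · refine ⟨u, v * d1 + w * m1, ?_⟩
      rw [← huvw]
      linear_combination (-v) * hd1 - w * hm1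
    · have hp' : Prime (p : ℤ) := Nat.prime_iff_prime_int.mp hp
      rw [isCoprime_comm, hp'.coprime_iff_not_dvd]
      intro hdvd
      have := Int.natAbs_dvd_natAbs.mpr hdvd
      have := Nat.le_of_dvd (Int.natAbs_pos.mpr hc) this
      simp at this
      omega

lemma redM_surj (M : ℕ) [NeZero M] : Function.Surjective (redM M) := by
  intro x
  have hMpos := NeZero.pos M
  have hdet := x.2
  rw [Matrix.det_fin_two] at hdet
  obtain ⟨a, ha⟩ := ZMod.intCast_surjective (x.1 0 0)
  obtain ⟨b, hb⟩ := ZMod.intCast_surjective (x.1 0 1)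
  obtain ⟨c, hc, hc0⟩ : ∃ c : ℤ, (c : ZMod M) = x.1 1 0 ∧ c ≠ 0 := by
    obtain ⟨c, hc⟩ := ZMod.intCast_surjective (x.1 1 0)
    by_cases h : c = 0
    · exact ⟨M, by rw [← hc, h]; simp, by exact_mod_cast hMpos.ne'⟩
    · exact ⟨c, hc, h⟩
  obtain ⟨d, hd⟩ := ZMod.intCast_surjective (x.1 1 1)
  have h1 : ((a * d - b * c : ℤ) : ZMod M) = ((1 : ℤ) : ZMod M) := by
    push_cast
    rw [ha, hb, hc, hd, hdet]
  rw [ZMod.intCast_eq_intCast_iff_dvd_sub] at h1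
  obtain ⟨w, hw⟩ := h1
  obtain ⟨d', hd', u, v, huv⟩ := exists_coprime_lift hMpos c d hc0 ⟨-b, a, w, by linear_combination -hw⟩
  have hd'' : (d' : ZMod M) = x.1 1 1 := by
    rw [← hd]
    exact ((ZMod.intCast_eq_intCast_iff_dvd_sub _ _ _).mpr hd').symm
  have huv' : (u : ZMod M) * x.1 1 0 + v * x.1 1 1 = 1 := by
    rw [← hc, ← hd'']; exact_mod_cast congr_arg (Int.cast : ℤ → ZMod M) huv
  let γ : SL(2, ℤ) := ⟨!![v + (a * u + b * v) * c, -u + (a * u + b * v) * d'; c, d'], by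
    rw [Matrix.det_fin_two_of]; linear_combination huv⟩
  refine ⟨γ, ?_⟩
  have key : ∀ i j, (redM M γ).1 i j = ((γ.1 i j : ℤ) : ZMod M) := fun i j => rfl
  apply Matrix.SpecialLinearGroup.ext
  intro i j
  refine (key i j).trans ?_
  fin_cases i <;> fin_cases j
  · show ((v + (a * u + b * v) * c : ℤ) : ZMod M) = x.1 0 0
    push_cast
    rw [ha, hb, hc]
    linear_combination x.1 0 0 * huv' - v * hdet
  · show ((-u + (a * u + b * v) * d' : ℤ) : ZMod M) = x.1 0 1
    push_cast
    rw [ha, hb, hd'']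
    linear_combination x.1 0 1 * huv' + u * hdet
  · exact hc
  · exact hd''

end surj

section gal
open scoped Matrix
variable {M : ℕ} [NeZero M]

lemma Gp_map (σ : ℂ ≃+* ℂ) (lam : ZMod M) (h : ∀ j : ZMod M, σ (ee j) = ee (lam * j)) (v : Fin 2 → ZMod M) :
    PowerSeries.map (σ : ℂ →+* ℂ) (Gp v) = Gp ![v 0, lam * v 1] := by
  have hu : ∀ (v : Fin 2 → ZMod M) c m, σ (uu v c m) = uu ![v 0, lam * v 1] c m := by
    intro v c m
    unfold uu
    simp only [Matrix.cons_val_zero, Matrix.cons_val_one]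
    by_cases hh : (c : ZMod M) = v 0
    · rw [if_pos hh, h]
      refine Eq.trans ?_ (if_pos hh).symm
      congr 1; ring
    · rw [if_neg hh, map_zero]
      exact (if_neg hh).symm
  have hc : ∀ b : ZMod M, σ (cst b) = cst (lam * b) := by
    intro b
    unfold cst
    simp only [map_mul, map_sum, map_div₀, map_pow, map_natCast, map_ofNat, map_ratCast, h]
    congr 1
    refine Finset.sum_congr rfl fun r _ => ?_
    congr 2; ring
  have hn : (-![v 0, lam * v 1] : Fin 2 → ZMod M) = ![(-v) 0, lam * (-v) 1] := by
    ext i; fin_cases i <;> simp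
  ext n
  unfold Gp
  rw [hn]
  simp only [map_sub, map_add, PowerSeries.coeff_map, PowerSeries.map_C, PowerSeries.coeff_mk, RingHom.coe_coe,
    map_sum, map_mul, map_pow, map_natCast, hu, Matrix.cons_val_zero, Matrix.cons_val_one]
  congr 4
  by_cases hh : v 0 = 0
  · rw [if_pos hh, hc]
    exact (if_pos hh).symm
  · rw [if_neg hh, map_zero]
    exact (if_neg hh).symm

lemma Gp_c1 (v : Fin 2 → ZMod M) : coeff 1 (Gp v) =
    (if 1 = v 0 then ee (v 1) else 0) - (if 1 = - v 0 then ee (- v 1) else 0) := by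
  unfold Gp uu
  simp only [map_sub, map_add, PowerSeries.coeff_C, PowerSeries.coeff_mk, Nat.divisorsAntidiagonal_one,
    Finset.sum_singleton]
  simp

lemma Gp_c2 (v : Fin 2 → ZMod M) : coeff 2 (Gp v) =
    (4 * (if 1 = v 0 then ee (2 * v 1) else 0) + (if 2 = v 0 then ee (v 1) else 0)) -
    (4 * (if 1 = - v 0 then ee (2 * (- v 1)) else 0) + (if 2 = - v 0 then ee (- v 1) else 0)) := by
  have d2 : Nat.divisorsAntidiagonal 2 = {(1, 2), (2, 1)} := by decide
  unfold Gp uu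
  simp only [map_sub, map_add, PowerSeries.coeff_C, PowerSeries.coeff_mk, d2]
  rw [Finset.sum_pair (by decide), Finset.sum_pair (by decide)]
  norm_num

lemma Gp_base (hM : 4 ≤ M) (w : Fin 2 → ZMod M) (h : Gp w = Gp (![1, 0] : Fin 2 → ZMod M)) : w = ![1, 0] := by
  have n1 : (1 : ZMod M) ≠ 0 := by
    intro h0
    have : ((1 : ℕ) : ZMod M) = 0 := by exact_mod_cast h0
    rw [ZMod.natCast_eq_zero_iff] at this
    exact absurd (Nat.le_of_dvd (by norm_num) this) (by omega)
  have n2 : (2 : ZMod M) ≠ 0 := by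
    intro h0
    have : ((2 : ℕ) : ZMod M) = 0 := by exact_mod_cast h0
    rw [ZMod.natCast_eq_zero_iff] at this
    exact absurd (Nat.le_of_dvd (by norm_num) this) (by omega)
  have n3 : (3 : ZMod M) ≠ 0 := by
    intro h0
    have : ((3 : ℕ) : ZMod M) = 0 := by exact_mod_cast h0
    rw [ZMod.natCast_eq_zero_iff] at this
    exact absurd (Nat.le_of_dvd (by norm_num) this) (by omega)
  have e11 : (1 : ZMod M) ≠ -1 := fun h => n2 (by linear_combination h)
  have e21 : (2 : ZMod M) ≠ 1 := fun h => n1 (by linear_combination h)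
  have e2m : (2 : ZMod M) ≠ -1 := fun h => n3 (by linear_combination h)
  have c1 := congr_arg (coeff 1) h
  have c2 := congr_arg (coeff 2) h
  rw [Gp_c1, Gp_c1] at c1
  rw [Gp_c2, Gp_c2] at c2
  have e11' : ¬ ((1 : ZMod M) = -(![1, 0] : Fin 2 → ZMod M) 0) := e11
  have e21' : ¬ ((2 : ZMod M) = (![1, 0] : Fin 2 → ZMod M) 0) := e21
  have e2m' : ¬ ((2 : ZMod M) = -(![1, 0] : Fin 2 → ZMod M) 0) := e2m
  have e1' : ((1 : ZMod M) = (![1, 0] : Fin 2 → ZMod M) 0) := rfl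
  rw [if_pos e1', if_neg e11'] at c1
  rw [if_pos e1', if_neg e11', if_neg e21', if_neg e2m'] at c2
  simp only [Matrix.cons_val_one, mul_zero, Matrix.cons_val_fin_one, AddChar.map_zero_eq_one] at c1 c2
  by_cases h1 : w 0 = 1
  · rw [h1, if_pos rfl, if_neg e11, sub_zero] at c1
    have : w 1 = 0 := by
      apply ZMod.injective_stdAddChar
      rw [AddChar.map_zero_eq_one]
      simpa using c1
    ext i; fin_cases i
    · exact h1
    · exact this
  · by_cases h2 : w 0 = -1
    · rw [h2, neg_neg, if_neg e11, if_pos rfl] at c1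
      rw [h2, neg_neg, if_neg e11, if_neg e2m, if_pos rfl, if_neg e21, two_mul, AddChar.map_add_eq_mul] at c2
      exfalso
      have c1' : (ee (- w 1) : ℂ) = -1 := by linear_combination -c1
      rw [c1'] at c2
      norm_num at c2
    · rw [if_neg (fun h => h1 h.symm), if_neg (fun h => h2 (by rw [h, neg_neg]))] at c1
      norm_num at c1

lemma Gp_inj (hM : 4 ≤ M) (x y : SL(2, ZMod M)) (h : Gp (x.1 0) = Gp (y.1 0)) : x.1 0 = y.1 0 := by
  obtain ⟨γ, hγ⟩ := redM_surj M x
  have h1 : Gv (x.1 0) = Gv (y.1 0) := HE.fun_unique (Gv_HE _) (h ▸ Gv_HE _)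
  have h2 : Gv (x.1 0 ᵥ* (redM M γ⁻¹).1) = Gv (y.1 0 ᵥ* (redM M γ⁻¹).1) := by
    funext τ
    have := congr_fun h1 (γ⁻¹ • τ)
    rw [Gv_smul, Gv_smul] at this
    exact mul_left_cancel₀ (pow_ne_zero 3 (denom_ne_zero _ _)) this
  have h3 : Gp (x.1 0 ᵥ* (redM M γ⁻¹).1) = Gp (y.1 0 ᵥ* (redM M γ⁻¹).1) :=
    HE.unique (M := M) (by omega) (Gv_HE _) (h2 ▸ Gv_HE _)
  have e : ∀ z w : SL(2, ZMod M), z.1 0 ᵥ* w.1 = (z * w).1 0 := by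
    intro z w
    exact (Matrix.mul_apply_eq_vecMul _ _ _).symm
  have hx : x.1 0 ᵥ* (redM M γ⁻¹).1 = ![1, 0] := by
    rw [e, map_inv, hγ, mul_inv_cancel]
    ext i; fin_cases i <;> simp
  rw [hx] at h3
  have h4 := Gp_base hM _ h3.symm
  rw [← hx] at h4
  have h5 := congr_arg (fun z => z ᵥ* (redM M γ).1) h4
  simp only [Matrix.vecMul_vecMul, ← Matrix.SpecialLinearGroup.coe_mul] at h5
  rw [← map_mul, inv_mul_cancel, map_one] at h5
  simpa using h5.symm

lemma Gp_inj1 (hM : 4 ≤ M) (x y : SL(2, ZMod M)) (h : Gp (x.1 1) = Gp (y.1 1)) : x.1 1 = y.1 1 := by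
  let S : SL(2, ZMod M) := ⟨!![0, 1; -1, 0], by simp⟩
  have e : ∀ z : SL(2, ZMod M), (S * z).1 0 = z.1 1 := by
    intro z
    ext j
    show ((!![0, 1; -1, 0] : Matrix (Fin 2) (Fin 2) (ZMod M)) * z.1) 0 j = _
    simp [Matrix.mul_apply, Fin.sum_univ_two]
  have := Gp_inj hM (S * x) (S * y) (by rw [e, e, h])
  rwa [e, e] at this

/-- the separating form -/
def Hf (t : ℕ) (x : SL(2, ZMod M)) : ℍ → ℂ := Gv (x.1 0) + (fun _ => (t : ℂ)) * Gv (x.1 1)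

/-- its expansion -/
def Hp (t : ℕ) (x : SL(2, ZMod M)) : ℂ⟦X⟧ := Gp (x.1 0) + C (t : ℂ) * Gp (x.1 1)

lemma H_HE (t : ℕ) (x : SL(2, ZMod M)) : HE M (Hf t x) (Hp t x) :=
  (Gv_HE _).add ((HE.const M _).mul (Gv_HE _))

lemma H_smul (t : ℕ) (x : SL(2, ZMod M)) (γ : SL(2, ℤ)) (τ : ℍ) :
    Hf t x (γ • τ) = denom γ τ ^ 3 * Hf t (x * redM M γ) τ := by
  have e : ∀ i, x.1 i ᵥ* (redM M γ).1 = (x * redM M γ).1 i := by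
    intro i
    exact (Matrix.mul_apply_eq_vecMul _ _ _).symm
  simp only [Hf, Pi.add_apply, Pi.mul_apply, Gv_smul, e]
  ring

lemma exists_t (hM : 4 ≤ M) : ∃ t : ℕ, Function.Injective (Hp (M := M) t) := by
  classical
  have hfin : ∀ p : SL(2, ZMod M) × SL(2, ZMod M), p.1 ≠ p.2 → {t : ℕ | Hp t p.1 = Hp t p.2}.Subsingleton := by
    rintro ⟨x, y⟩ hxy t ht s hs
    simp only [Set.mem_ofPred_eq, Hp] at ht hs hxy
    by_contra hts
    have hC : (C (t : ℂ) - C (s : ℂ)) ≠ 0 := by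
      rw [← map_sub]
      intro h0
      have := (map_eq_zero_iff (C (R := ℂ)) PowerSeries.C_injective).mp h0
      exact hts (by exact_mod_cast sub_eq_zero.mp this)
    have h1 : (C (t : ℂ) - C (s : ℂ)) * (Gp (x.1 1) - Gp (y.1 1)) = 0 := by
      linear_combination ht - hs
    have h2 : Gp (x.1 1) = Gp (y.1 1) := sub_eq_zero.mp ((mul_eq_zero.mp h1).resolve_left hC)
    rw [h2] at ht
    have h3 := add_right_cancel ht
    apply hxy
    have a0 := Gp_inj hM _ _ h3
    have a1 := Gp_inj1 hM _ _ h2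
    apply Matrix.SpecialLinearGroup.ext
    intro i j
    fin_cases i
    · exact congr_fun a0 j
    · exact congr_fun a1 j
  have hfin2 : (⋃ p ∈ {p : SL(2, ZMod M) × SL(2, ZMod M) | p.1 ≠ p.2}, {t : ℕ | Hp t p.1 = Hp t p.2}).Finite :=
    Set.Finite.biUnion (Set.toFinite _) fun p hp => (hfin p hp).finite
  obtain ⟨t, ht⟩ := hfin2.exists_notMem
  refine ⟨t, fun x y hxy => ?_⟩
  by_contra hne
  exact ht (Set.mem_biUnion (x := (x, y)) hne hxy)

lemma exists_lam (σ : ℂ ≃+* ℂ) : ∃ lam : (ZMod M)ˣ, ∀ j : ZMod M, σ (ee j) = ee ((lam : ZMod M) * j) := by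
  have hp : IsPrimitiveRoot (ee (1 : ZMod M) : ℂ) M := by
    have := Complex.isPrimitiveRoot_exp M (NeZero.ne M)
    convert this using 1
    have := ZMod.stdAddChar_coe (N := M) 1
    push_cast at this
    rw [this]
    simp
  have h1 : (σ (ee (1 : ZMod M))) ^ M = 1 := by
    rw [← map_pow, hp.pow_eq_one, map_one]
  obtain ⟨i, -, hi⟩ := hp.eq_pow_of_pow_eq_one h1
  have h2 : ∀ j : ZMod M, σ (ee j) = ee ((i : ZMod M) * j) := by
    intro j
    obtain ⟨n, rfl⟩ := ZMod.natCast_zmod_surjective j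
    have a1 : ∀ n : ℕ, (ee (n : ZMod M) : ℂ) = ee (1 : ZMod M) ^ n := by
      intro n
      rw [← AddChar.map_nsmul_eq_pow]; simp
    rw [a1 n, map_pow, ← hi, ← Nat.cast_mul, a1, pow_mul]
  have hinj : Function.Injective (fun j : ZMod M => (i : ZMod M) * j) := by
    intro a b hab
    apply ZMod.injective_stdAddChar
    apply σ.injective
    have ha := h2 a
    have hb := h2 b
    simp only at hab
    rw [hab, ← hb] at ha
    exact ha
  have hsurj := Finite.surjective_of_injective hinj
  obtain ⟨j, hj⟩ := hsurj 1
  exact ⟨Units.mkOfMulEqOne _ _ hj, h2⟩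

end gal

section final
open scoped Matrix

lemma HE.sum {M : ℕ} {ι : Type*} (s : Finset ι) {F : ι → ℍ → ℂ} {p : ι → ℂ⟦X⟧} (h : ∀ i, HE M (F i) (p i)) :
    HE M (∑ i ∈ s, F i) (∑ i ∈ s, p i) := by
  classical
  induction s using Finset.induction_on with
  | empty => rw [Finset.sum_empty, Finset.sum_empty, ← map_zero (C (R := ℂ))]; exact HE.const M 0
  | insert a s ha ih => rw [Finset.sum_insert ha, Finset.sum_insert ha]; exact (h a).add ih

lemma HE.pow {M : ℕ} {F : ℍ → ℂ} {p : ℂ⟦X⟧} (h : HE M F p) (i : ℕ) : HE M (F ^ i) (p ^ i) := by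
  induction i with
  | zero => rw [pow_zero, pow_zero, ← map_one (C (R := ℂ))]; exact HE.const M 1
  | succ i ih => rw [pow_succ, pow_succ]; exact ih.mul h

lemma smul_of_slash {k : ℤ} {f g : ℍ → ℂ} {γ : SL(2, ℤ)} (h : f ∣[k] γ = g) (τ : ℍ) :
    f (γ • τ) = denom γ τ ^ k * g τ := by
  rw [← h, ModularForm.SL_slash_apply, mul_comm, mul_assoc, ← zpow_add₀ (denom_ne_zero _ _)]
  simp

lemma slash_of_smul {k : ℤ} {f g : ℍ → ℂ} {γ : SL(2, ℤ)} (h : ∀ τ : ℍ, f (γ • τ) = denom γ τ ^ k * g τ) :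
    f ∣[k] γ = g := by
  funext τ
  rw [ModularForm.SL_slash_apply, h, mul_comm, ← mul_assoc, ← zpow_add₀ (denom_ne_zero _ _)]
  simp

lemma redM_apply (M : ℕ) (γ : SL(2, ℤ)) (i j) : (redM M γ).1 i j = ((γ.1 i j : ℤ) : ZMod M) := rfl

variable {M : ℕ} [NeZero M] {k : ℤ} {f : ℍ → ℂ}

lemma slash_congr (hinv : ∀ γ, redM M γ = 1 → f ∣[k] γ = f) {γ δ : SL(2, ℤ)} (h : redM M γ = redM M δ) :
    f ∣[k] γ = f ∣[k] δ := by
  have h1 : γ = (γ * δ⁻¹) * δ := by simp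
  rw [h1, SlashAction.slash_mul, hinv]
  rw [map_mul, map_inv, h, mul_inv_cancel]

lemma slash_HE (hinv : ∀ γ, redM M γ = 1 → f ∣[k] γ = f) (hd : MDiff f)
    (hb : ∀ γ : SL(2, ℤ), IsBoundedAtImInfty (f ∣[k] γ)) (γ : SL(2, ℤ)) :
    HE M (f ∣[k] γ) (UpperHalfPlane.qExpansion (M : ℝ) (f ∣[k] γ)) := by
  refine HE_of_periodic (NeZero.pos M) ?_ (hd.slash k _) (hb γ)
  intro τ
  have h1 : (f ∣[k] γ) ∣[k] (ModularGroup.T ^ (M : ℤ)) = f ∣[k] γ := by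
    rw [← SlashAction.slash_mul]
    apply slash_congr hinv
    have : redM M (ModularGroup.T ^ (M : ℤ)) = 1 := by
      apply Matrix.SpecialLinearGroup.ext
      intro i j
      rw [redM_apply, ModularGroup.coe_T_zpow]
      fin_cases i <;> fin_cases j <;> simp
    rw [map_mul, this, mul_one]
  have h2 := smul_of_slash h1 τ
  rw [UpperHalfPlane.modular_T_zpow_smul] at h2
  have h3 : denom (ModularGroup.T ^ (M : ℤ) : SL(2, ℤ)) τ = 1 := by
    rw [ModularGroup.denom_apply]
    have := ModularGroup.coe_T_zpow (M : ℤ)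
    rw [this]
    simp
  rw [h3] at h2
  simpa using h2

/-- make a level one form -/
lemma mk_form (w : ℤ) (L : ℍ → ℂ) (p : ℂ⟦X⟧) (hp : HE M L p)
    (h : ∀ (γ : SL(2, ℤ)) (τ : ℍ), L (γ • τ) = denom γ τ ^ w * L τ) : ∃ F : ModularForm 𝒮ℒ w, ⇑F = L := by
  have hs : ∀ γ : SL(2, ℤ), L ∣[w] γ = L := fun γ => slash_of_smul (h γ)
  refine ⟨{ toFun := L, slash_action_eq' := ?_, holo' := hp.mdiff (NeZero.pos M), bdd_at_cusps' := ?_ }, rfl⟩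
  · rintro _ ⟨γ, rfl⟩
    exact hs γ
  · intro c hc
    rw [OnePoint.isBoundedAt_iff_forall_SL2Z hc]
    intro γ _
    rw [hs]
    exact hp.bdd (NeZero.pos M)

lemma exists_n (hk : 1 ≤ k) (τ : ℍ) : ∃ n : ℤ, ((n * M : ℂ) * τ + 1) ^ k ≠ 1 := by
  have hM : (0 : ℝ) < M := by exact_mod_cast NeZero.pos M
  have key : ∀ n : ℤ, n ≠ 0 → 0 ≤ n * τ.re → ((n * M : ℂ) * τ + 1) ^ k ≠ 1 := by
    intro n hn h0 h1
    have h2 : 1 < ‖((n * M : ℂ) * τ + 1)‖ := by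
      have h3 : 1 < Complex.normSq ((n * M : ℂ) * τ + 1) := by
        have hre : ((n * M : ℂ) * τ + 1).re = M * (n * τ.re) + 1 := by
          simp [Complex.mul_re]; ring
        have him : ((n * M : ℂ) * τ + 1).im = n * (M * τ.im) := by
          simp [Complex.mul_im]; ring
        rw [Complex.normSq_apply, hre, him]
        have a1 : 0 ≤ M * (n * τ.re) := by positivity
        have a2 : 0 < M * τ.im := mul_pos hM τ.im_pos
        have a3 : (n : ℝ) * (M * τ.im) ≠ 0 := mul_ne_zero (by exact_mod_cast hn) a2.ne'
        nlinarith [mul_self_pos.mpr a3]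
      rw [Complex.normSq_eq_norm_sq] at h3
      nlinarith [norm_nonneg ((n * M : ℂ) * τ + 1)]
    have h4 := one_lt_zpow₀ h2 (show 0 < k by omega)
    rw [← norm_zpow, h1] at h4
    simp at h4
  rcases le_total 0 τ.re with h | h
  · exact ⟨1, key 1 one_ne_zero (by simpa using h)⟩
  · exact ⟨-1, key (-1) (by norm_num) (by simpa using h)⟩

/-- twisted separating form -/
def Kf (lam : ZMod M) (t : ℕ) (x : SL(2, ZMod M)) : ℍ → ℂ :=
  Gv ![x.1 0 0, lam * x.1 0 1] + (fun _ => (t : ℂ)) * Gv ![x.1 1 0, lam * x.1 1 1]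

/-- conjugation by diag(1, lam) -/
def psi (lam : (ZMod M)ˣ) (γ : SL(2, ℤ)) : SL(2, ZMod M) :=
  ⟨!![((γ.1 0 0 : ℤ) : ZMod M), (lam⁻¹ : (ZMod M)ˣ) * ((γ.1 0 1 : ℤ) : ZMod M);
      lam * ((γ.1 1 0 : ℤ) : ZMod M), ((γ.1 1 1 : ℤ) : ZMod M)], by
    have h := (redM M γ).2
    rw [Matrix.det_fin_two] at h
    simp only [redM_apply] at h
    rw [Matrix.det_fin_two_of, ← h]
    have h2 : ((lam⁻¹ : (ZMod M)ˣ) : ZMod M) * lam = 1 := by simp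
    linear_combination (-((γ.1 0 1 : ℤ) : ZMod M) * ((γ.1 1 0 : ℤ) : ZMod M)) * h2⟩

lemma K_HE (σ : ℂ ≃+* ℂ) (lam : ZMod M) (h : ∀ j : ZMod M, σ (ee j) = ee (lam * j)) (t : ℕ)
    (x : SL(2, ZMod M)) : HE M (Kf lam t x) (PowerSeries.map (σ : ℂ →+* ℂ) (Hp t x)) := by
  unfold Hp Kf
  rw [map_add, map_mul, PowerSeries.map_C, Gp_map σ lam h, Gp_map σ lam h, RingHom.coe_coe, map_natCast]
  exact (Gv_HE _).add ((HE.const M _).mul (Gv_HE _))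

lemma K_smul (lam : (ZMod M)ˣ) (t : ℕ) (x : SL(2, ZMod M)) (γ : SL(2, ℤ)) (τ : ℍ) :
    Kf (lam : ZMod M) t x (γ • τ) = denom γ τ ^ 3 * Kf (lam : ZMod M) t (x * psi lam γ) τ := by
  have h2 : (lam : ZMod M) * ((lam⁻¹ : (ZMod M)ˣ) : ZMod M) = 1 := by simp
  have e : ∀ i, ![x.1 i 0, (lam : ZMod M) * x.1 i 1] ᵥ* (redM M γ).1 =
      ![(x * psi lam γ).1 i 0, (lam : ZMod M) * (x * psi lam γ).1 i 1] := by
    intro i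
    ext j
    have e1 : ∀ j, (x * psi lam γ).1 i j = x.1 i 0 * (psi lam γ).1 0 j + x.1 i 1 * (psi lam γ).1 1 j := by
      intro j
      show (x.1 * (psi lam γ).1) i j = _
      simp [Matrix.mul_apply, Fin.sum_univ_two]
    rw [e1, e1]
    simp only [Matrix.vecMul, dotProduct, Fin.sum_univ_two, redM_apply, Matrix.cons_val_zero,
      Matrix.cons_val_one, Matrix.cons_val_fin_one]
    fin_cases j
    · show _ = x.1 i 0 * ((γ.1 0 0 : ℤ) : ZMod M) + x.1 i 1 * (lam * ((γ.1 1 0 : ℤ) : ZMod M))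
      show x.1 i 0 * ((γ.1 0 0 : ℤ) : ZMod M) + lam * x.1 i 1 * ((γ.1 1 0 : ℤ) : ZMod M) = _
      ring
    · show _ = lam * (x.1 i 0 * ((lam⁻¹ : (ZMod M)ˣ) * ((γ.1 0 1 : ℤ) : ZMod M)) +
        x.1 i 1 * ((γ.1 1 1 : ℤ) : ZMod M))
      show x.1 i 0 * ((γ.1 0 1 : ℤ) : ZMod M) + lam * x.1 i 1 * ((γ.1 1 1 : ℤ) : ZMod M) = _
      linear_combination (-x.1 i 0 * ((γ.1 0 1 : ℤ) : ZMod M)) * h2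
  simp only [Kf, Pi.add_apply, Pi.mul_apply, Gv_smul, e]
  ring

lemma galois (hM : 4 ≤ M) (hk : 1 ≤ k) (hinv : ∀ γ, redM M γ = 1 → f ∣[k] γ = f) (hd : MDiff f)
    (hb : ∀ γ : SL(2, ℤ), IsBoundedAtImInfty (f ∣[k] γ)) (σ : ℂ ≃+* ℂ) (lam : (ZMod M)ˣ)
    (hlam : ∀ j : ZMod M, σ (ee j) = ee ((lam : ZMod M) * j)) (p : ℂ⟦X⟧) (hp : HE M f p)
    (hσ : ∀ n, 1 ≤ n → σ (coeff n p) = coeff n p) (g γ : SL(2, ℤ)) (hγ : psi lam γ = redM M g)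
    (pg : ℂ⟦X⟧) (hpg : HE M (f ∣[k] g) pg) :
    HE M (f ∣[k] γ) (PowerSeries.map (σ : ℂ →+* ℂ) pg) := by
  classical
  have hM0 : 0 < M := NeZero.pos M
  obtain ⟨t, ht⟩ := exists_t hM
  choose lift hlift using redM_surj M
  let fx : SL(2, ZMod M) → ℍ → ℂ := fun x => f ∣[k] (lift x)
  let fp : SL(2, ZMod M) → ℂ⟦X⟧ := fun x => UpperHalfPlane.qExpansion (M : ℝ) (fx x)
  have hfx : ∀ x, HE M (fx x) (fp x) := fun x => slash_HE hinv hd hb _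
  have hfxγ : ∀ γ : SL(2, ℤ), fx (redM M γ) = f ∣[k] γ := fun γ => slash_congr hinv (hlift _)
  have hfxs : ∀ x (γ : SL(2, ℤ)) (τ : ℍ), fx x (γ • τ) = denom γ τ ^ k * fx (x * redM M γ) τ := by
    intro x γ τ
    apply smul_of_slash
    rw [← SlashAction.slash_mul]
    apply slash_congr hinv
    rw [map_mul, hlift, hlift]
  -- trace forms
  have hL : ∀ i : ℕ, ∃ (l' : ℍ → ℂ), HE M l' (∑ x, PowerSeries.map (σ : ℂ →+* ℂ) (fp x) *
      (PowerSeries.map (σ : ℂ →+* ℂ) (Hp t x)) ^ i) ∧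
      ∀ (γ : SL(2, ℤ)) (τ : ℍ), l' (γ • τ) = denom γ τ ^ k * (denom γ τ ^ 3) ^ i * l' τ := by
    intro i
    have hLp : HE M (∑ x, fx x * Hf t x ^ i) (∑ x, fp x * Hp t x ^ i) :=
      HE.sum _ fun x => (hfx x).mul ((H_HE t x).pow i)
    have hpw : ∀ (γ : SL(2, ℤ)) (τ : ℍ), denom γ τ ^ (k + 3 * (i : ℤ)) = denom γ τ ^ k * (denom γ τ ^ 3) ^ i := by
      intro γ τ
      rw [zpow_add₀ (denom_ne_zero _ _), ← pow_mul, ← zpow_natCast]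
      push_cast
      rfl
    obtain ⟨F, hF⟩ := mk_form (k + 3 * (i : ℤ)) _ _ hLp (by
      intro γ τ
      rw [hpw]
      simp only [Finset.sum_apply, Pi.mul_apply, Pi.pow_apply, hfxs, H_smul]
      rw [Finset.mul_sum, ← Equiv.sum_comp (Equiv.mulRight (redM M γ)) (fun x => denom γ τ ^ k * (denom γ τ ^ 3) ^ i *
        (fx x τ * Hf t x τ ^ i))]
      refine Finset.sum_congr rfl fun x _ => ?_
      simp only [Equiv.coe_mulRight, mul_pow]
      ring)
    obtain ⟨F', hF'⟩ := levelone σ ((k + 3 * (i : ℤ)).toNat + 1) (k + 3 * (i : ℤ)) (by omega) F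
    have h1 : HE M F (stretch M (UpperHalfPlane.qExpansion 1 F)) := by
      simpa using (HE_one F).stretch one_pos hM0
    have h2 : HE M F' (stretch M (UpperHalfPlane.qExpansion 1 F')) := by
      simpa using (HE_one F').stretch one_pos hM0
    rw [hF] at h1
    have h3 := HE.unique hM0 hLp h1
    refine ⟨F', ?_, ?_⟩
    · have h4 := congr_arg (PowerSeries.map (σ : ℂ →+* ℂ)) h3
      rw [hF', hF, ← map_stretch, ← h4] at h2
      simpa only [map_sum, map_mul, map_pow] using h2
    · intro γ τ
      rw [← hpw]
      apply smul_of_slash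
      exact F'.slash_action_eq' _ ⟨γ, rfl⟩
  choose l' hl' hlγ' using hL
  have hfp1 : fp 1 = p := by
    have h1 : fx 1 = f := by
      rw [← map_one (redM M), hfxγ, SlashAction.slash_one]
    exact HE.unique hM0 (h1 ▸ hfx 1) hp
  set δ0 : ℂ := σ (coeff 0 p) - coeff 0 p with hδ
  have hb1 : PowerSeries.map (σ : ℂ →+* ℂ) (fp 1) = p + C δ0 := by
    rw [hfp1]
    ext n
    rw [PowerSeries.coeff_map, map_add, PowerSeries.coeff_C]
    rcases Nat.eq_zero_or_pos n with rfl | hn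
    · simp [hδ]
    · simp [hσ n hn, hn.ne']
  obtain ⟨Q, R, Qp, Rp, hQ, hR, hQ0, hQR, hfin⟩ := core (M := M) (Kf (lam : ZMod M) t)
    (fun x => PowerSeries.map (σ : ℂ →+* ℂ) (Hp t x)) (K_HE σ _ hlam t)
    (fun x y hxy => ht (PowerSeries.map_injective (σ : ℂ →+* ℂ) σ.injective hxy)) (psi lam) k
    (K_smul lam t) (fun x => PowerSeries.map (σ : ℂ →+* ℂ) (fp x)) l' _ hl' (fun i => rfl) hlγ'
    (f + fun _ => δ0) (by simp only [hb1]; exact hp.add (HE.const M δ0)) hM0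
  have hδ0 : δ0 = 0 := by
    by_contra hne
    apply hQ0 1
    have hQz : Q 1 = 0 := by
      funext τ
      obtain ⟨n, hn⟩ := exists_n (M := M) hk τ
      let γ : SL(2, ℤ) := ⟨!![1, 0; n * M, 1], by simp⟩
      have hψ : psi lam γ = 1 := by
        apply Matrix.SpecialLinearGroup.ext
        intro i j
        fin_cases i <;> fin_cases j <;> simp [psi, γ]
      have hred : redM M γ = 1 := by
        apply Matrix.SpecialLinearGroup.ext
        intro i j
        rw [redM_apply]
        fin_cases i <;> fin_cases j <;> simp [γ]
      have hψ1 : psi lam 1 = 1 := by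
        apply Matrix.SpecialLinearGroup.ext
        intro i j
        fin_cases i <;> fin_cases j <;> simp [psi]
      have hden : denom γ τ = (n * M : ℂ) * τ + 1 := by
        rw [ModularGroup.denom_apply]
        simp [γ]
      have h1 := hfin γ τ
      have h2 := hfin 1 τ
      rw [hψ] at h1
      rw [hψ1] at h2
      have h3 := smul_of_slash (hinv γ hred) τ
      simp only [Pi.add_apply, h3] at h1
      rw [hden] at h1
      simp only [one_smul, Pi.add_apply] at h2
      have hd1 : denom (1 : SL(2, ℤ)) τ = 1 := by
        rw [ModularGroup.denom_apply]
        simp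
      rw [hd1, one_zpow, one_mul] at h2
      rw [← h2] at h1
      have h4 : δ0 * (1 - ((n * M : ℂ) * τ + 1) ^ k) * Q 1 τ = 0 := by
        linear_combination h1
      have h5 : 1 - ((n * M : ℂ) * τ + 1) ^ k ≠ 0 := sub_ne_zero.mpr (Ne.symm hn)
      simpa [hne, h5] using h4
    exact HE.zero_unique hM0 hQz (hQ 1)
  have hfin' := hfin γ
  rw [hγ] at hfin'
  have h1 : (f ∣[k] γ) * Q (redM M g) = R (redM M g) := by
    funext τ
    have := hfin' τ
    rw [hδ0] at this
    simp only [Pi.add_apply, add_zero] at this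
    rw [Pi.mul_apply, ModularForm.SL_slash_apply, mul_right_comm, this, mul_right_comm,
      ← zpow_add₀ (denom_ne_zero _ _)]
    simp
  have h2 := slash_HE hinv hd hb γ
  have h3 := HE.unique hM0 (h2.mul (hQ (redM M g))) (h1 ▸ hR _)
  rw [← hQR] at h3
  have h4 := mul_right_cancel₀ (hQ0 _) h3
  rw [h4] at h2
  have h5 : fp (redM M g) = pg := HE.unique hM0 (hfxγ g ▸ hfx _) hpg
  rw [h5] at h2
  exact h2

end final
end S8

theorem stmt_8 (N : ℕ) (hN : 1 ≤ N) (k : ℤ) (hk : 1 ≤ k)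
    (χ : DirichletCharacter ℂ N)
    (f : ModularForm (Gamma1 N) k)
    (hχf : ∀ γ : SL(2, ℤ), γ ∈ Gamma0 N →
      ⇑f ∣[k] γ = χ ((γ 1 1 : ℤ) : ZMod N) • ⇑f)
    (a : ℕ → ℂ) (ha : HasExpansion 1 (⇑f) a)
    (g : SL(2, ℤ)) (N' : ℕ) (hN' : N' = N / Int.gcd (g 1 0 * g 1 1) N)
    (σ : ℂ ≃+* ℂ) (hσa : ∀ n : ℕ, 1 ≤ n → σ (a n) = a n)
    (lam lam' : ℤ) (hσζ : σ (zetaC N) = zetaC N ^ lam)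
    (hlam1 : lam ≡ 1 [ZMOD (N' : ℤ)])
    (hlam' : lam * lam' ≡ 1 [ZMOD (N : ℤ)])
    (c : ℕ → ℂ) (hc : HasExpansion N (⇑f ∣[k] g) c) :
    ∀ n : ℕ, σ (c n) =
      χ ((g 0 0 * g 1 1 - lam' * g 0 1 * g 1 0 : ℤ) : ZMod N) * c n := by
  have : NeZero N := ⟨by omega⟩
  have : NeZero (4 * N) := ⟨by omega⟩
  have hcast : ∀ x y : ℤ, ((x : ℤ) : ZMod (4 * N)) = y → ((x : ℤ) : ZMod N) = y := by
    intro x y h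
    rw [ZMod.intCast_eq_intCast_iff_dvd_sub] at h ⊢
    push_cast at h
    exact dvd_trans (Dvd.intro_left _ rfl) h
  have hinv : ∀ γ : SL(2, ℤ), S8.redM (4 * N) γ = 1 → ⇑f ∣[k] γ = ⇑f := by
    intro γ hγ
    have e : ∀ i j, ((γ i j : ℤ) : ZMod (4 * N)) = (((1 : SL(2, ℤ)) i j : ℤ) : ZMod (4 * N)) := by
      intro i j
      rw [← map_one (S8.redM (4 * N))] at hγ
      have := congr_arg (fun z : SL(2, ZMod (4 * N)) => z.1 i j) hγ
      simpa only [S8.redM_apply] using this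
    have h10 := hcast _ _ (e 1 0)
    have h11 := hcast _ _ (e 1 1)
    rw [hχf γ (Gamma0_mem.mpr (by rw [h10]; simp)), h11]
    simp
  have hb : ∀ γ : SL(2, ℤ), IsBoundedAtImInfty (⇑f ∣[k] γ) := by
    intro γ
    have hcu : IsCusp (Matrix.SpecialLinearGroup.mapGL ℝ γ • OnePoint.infty) 𝒮ℒ := by
      rw [isCusp_SL2Z_iff']
      exact ⟨γ, rfl⟩
    have h := f.bdd_at_cusps' ((Subgroup.IsArithmetic.isCusp_iff_isCusp_SL2Z _).mpr hcu)
    exact (OnePoint.isBoundedAt_iff_forall_SL2Z hcu).mp h γ rfl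
  obtain ⟨L, hL⟩ := S8.exists_lam (M := 4 * N) σ
  obtain ⟨m, hm⟩ := ZMod.intCast_surjective (L : ZMod (4 * N))
  obtain ⟨m', hm'⟩ := ZMod.intCast_surjective ((L⁻¹ : (ZMod (4 * N))ˣ) : ZMod (4 * N))
  have hz : ∀ j : ℤ, (S8.ee ((4 * j : ℤ) : ZMod (4 * N)) : ℂ) = zetaC N ^ j := by
    intro j
    have hN0 : (N : ℂ) ≠ 0 := by exact_mod_cast (NeZero.ne N)
    rw [ZMod.stdAddChar_coe, zetaC, ← Complex.exp_int_mul]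
    congr 1
    push_cast
    field_simp
  have hmlam : (N : ℤ) ∣ lam - m := by
    have h1 : (S8.ee ((4 * m : ℤ) : ZMod (4 * N)) : ℂ) = S8.ee ((4 * lam : ℤ) : ZMod (4 * N)) := by
      rw [hz lam, ← hσζ]
      have := hz 1
      rw [zpow_one] at this
      rw [← this, hL, ← hm]
      congr 1
      push_cast
      ring
    have h2 := ZMod.injective_stdAddChar h1
    rw [ZMod.intCast_eq_intCast_iff_dvd_sub] at h2
    push_cast at h2
    rw [← mul_sub] at h2
    exact (mul_dvd_mul_iff_left (by norm_num)).mp h2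
  have hmm' : (N : ℤ) ∣ m * m' - 1 := by
    have : ((1 : ℤ) : ZMod (4 * N)) = ((m * m' : ℤ) : ZMod (4 * N)) := by
      push_cast
      rw [hm, hm']; simp
    have := hcast _ _ this
    rwa [ZMod.intCast_eq_intCast_iff_dvd_sub] at this
  have hll : (N : ℤ) ∣ lam * lam' - 1 := (Int.modEq_iff_dvd.mp hlam'.symm)
  have hm'lam : (N : ℤ) ∣ m' - lam' := by
    have h1 : m' - lam' = m' * -(lam * lam' - 1) + lam' * (m * m' - 1) + m' * lam' * (lam - m) := by ring
    rw [h1]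
    exact dvd_add (dvd_add (Dvd.dvd.mul_left ((dvd_neg).mpr hll) _) (Dvd.dvd.mul_left hmm' _)) (Dvd.dvd.mul_left hmlam _)
  have hgdet : g 0 0 * g 1 1 - g 0 1 * g 1 0 = 1 := by
    have := g.2
    rwa [Matrix.det_fin_two] at this
  obtain ⟨γ, hγ⟩ := S8.redM_surj (4 * N) ⟨!![((g 0 0 : ℤ) : ZMod (4 * N)), ((m * g 0 1 : ℤ) : ZMod (4 * N));
    ((m' * g 1 0 : ℤ) : ZMod (4 * N)), ((g 1 1 : ℤ) : ZMod (4 * N))], by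
      rw [Matrix.det_fin_two_of]
      have h1 : (m : ZMod (4 * N)) * m' = 1 := by rw [hm, hm']; simp
      have h2 := congr_arg (Int.cast : ℤ → ZMod (4 * N)) hgdet
      push_cast at h2 ⊢
      linear_combination h2 - ((g 0 1 : ℤ) : ZMod (4 * N)) * ((g 1 0 : ℤ) : ZMod (4 * N)) * h1⟩
  have hent : ∀ i j, ((γ.1 i j : ℤ) : ZMod (4 * N)) = (!![((g 0 0 : ℤ) : ZMod (4 * N)), ((m * g 0 1 : ℤ) : ZMod (4 * N));
    ((m' * g 1 0 : ℤ) : ZMod (4 * N)), ((g 1 1 : ℤ) : ZMod (4 * N))] : Matrix (Fin 2) (Fin 2) (ZMod (4 * N))) i j := by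
    intro i j
    have := congr_arg (fun z : SL(2, ZMod (4 * N)) => z.1 i j) hγ
    simpa only [S8.redM_apply] using this
  have h00 : ((γ.1 0 0 : ℤ) : ZMod (4 * N)) = ((g 0 0 : ℤ) : ZMod (4 * N)) := hent 0 0
  have h01 : ((γ.1 0 1 : ℤ) : ZMod (4 * N)) = ((m * g 0 1 : ℤ) : ZMod (4 * N)) := hent 0 1
  have h10 : ((γ.1 1 0 : ℤ) : ZMod (4 * N)) = ((m' * g 1 0 : ℤ) : ZMod (4 * N)) := hent 1 0
  have h11 : ((γ.1 1 1 : ℤ) : ZMod (4 * N)) = ((g 1 1 : ℤ) : ZMod (4 * N)) := hent 1 1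
  have hpsi : S8.psi L γ = S8.redM (4 * N) g := by
    apply Matrix.SpecialLinearGroup.ext
    intro i j
    rw [S8.redM_apply]
    fin_cases i <;> fin_cases j
    · exact h00
    · show (L⁻¹ : (ZMod (4 * N))ˣ) * ((γ.1 0 1 : ℤ) : ZMod (4 * N)) = ((g 0 1 : ℤ) : ZMod (4 * N))
      rw [h01]; push_cast; rw [hm, ← mul_assoc]; simp
    · show L * ((γ.1 1 0 : ℤ) : ZMod (4 * N)) = ((g 1 0 : ℤ) : ZMod (4 * N))
      rw [h10]; push_cast; rw [hm', ← mul_assoc]; simp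
    · exact h11
  -- expansions
  have hp1 : S8.HE (4 * N) f (S8.stretch (4 * N) (PowerSeries.mk a)) := by
    simpa using (S8.HE_of_hasExpansion ha).stretch one_pos (show 0 < 4 * N by omega)
  have hp2 : S8.HE (4 * N) (⇑f ∣[k] g) (S8.stretch 4 (PowerSeries.mk c)) :=
    (S8.HE_of_hasExpansion hc).stretch (by omega) (by norm_num)
  have hmain := S8.galois (M := 4 * N) (by omega) hk hinv f.holo' hb σ L hL _ hp1 (by
    intro n hn
    simp only [S8.stretch, PowerSeries.coeff_mk]
    split_ifs with hd
    · exact hσa _ (Nat.div_pos (Nat.le_of_dvd hn hd) (by omega))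
    · simp) g γ hpsi _ hp2
  -- relation between γ and g
  have hNd : (N : ℤ) ∣ (lam' - 1) * (g 1 0 * g 1 1) := by
    have hgd : (Int.gcd (g 1 0 * g 1 1) N : ℤ) ∣ g 1 0 * g 1 1 := Int.gcd_dvd_left ..
    have hgN : Int.gcd (g 1 0 * g 1 1) N ∣ N := by
      have : (Int.gcd (g 1 0 * g 1 1) N : ℤ) ∣ (N : ℤ) := Int.gcd_dvd_right ..
      exact_mod_cast this
    have h1 : ((N' * Int.gcd (g 1 0 * g 1 1) N : ℕ) : ℤ) = N := by
      rw [hN', Nat.div_mul_cancel hgN]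
    have h2 : (N' : ℤ) ∣ lam - 1 := Int.modEq_iff_dvd.mp hlam1.symm
    have h3 : (N : ℤ) ∣ (lam - 1) * (g 1 0 * g 1 1) := by
      rw [← h1]; push_cast
      exact mul_dvd_mul h2 hgd
    have h4 : (lam' - 1) * (g 1 0 * g 1 1) = (-lam') * ((lam - 1) * (g 1 0 * g 1 1)) +
      (g 1 0 * g 1 1) * (lam * lam' - 1) := by ring
    rw [h4]
    exact dvd_add (Dvd.dvd.mul_left h3 _) (Dvd.dvd.mul_left hll _)
  have k10 : ((γ.1 1 0 : ℤ) : ZMod N) = (lam' : ZMod N) * ((g 1 0 : ℤ) : ZMod N) := by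
    rw [hcast _ _ h10]
    push_cast
    congr 1
    rw [eq_comm, ZMod.intCast_eq_intCast_iff_dvd_sub]
    exact hm'lam
  have k11 : ((γ.1 1 1 : ℤ) : ZMod N) = ((g 1 1 : ℤ) : ZMod N) := hcast _ _ h11
  have ginv : ∀ j, (γ * g⁻¹).1 1 j = γ.1 1 0 * (g⁻¹).1 0 j + γ.1 1 1 * (g⁻¹).1 1 j := by
    intro j
    show (γ.1 * (g⁻¹).1) 1 j = _
    simp [Matrix.mul_apply, Fin.sum_univ_two]
  have gi : (g⁻¹).1 = !![g 1 1, -g 0 1; -g 1 0, g 0 0] := by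
    rw [Matrix.SpecialLinearGroup.coe_inv, Matrix.adjugate_fin_two]
  have η10 : (γ * g⁻¹).1 1 0 = γ.1 1 0 * g 1 1 + γ.1 1 1 * (- g 1 0) := by
    rw [ginv, gi]; rfl
  have η11 : (γ * g⁻¹).1 1 1 = γ.1 1 0 * (-g 0 1) + γ.1 1 1 * g 0 0 := by
    rw [ginv, gi]; rfl
  have hη0 : γ * g⁻¹ ∈ Gamma0 N := by
    rw [Gamma0_mem]
    show (((γ * g⁻¹).1 1 0 : ℤ) : ZMod N) = 0
    rw [η10]
    have := (ZMod.intCast_zmod_eq_zero_iff_dvd _ N).mpr hNd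
    push_cast at this ⊢
    rw [k10, k11]
    linear_combination this
  have hη := hχf _ hη0
  have e11 : (((γ * g⁻¹) 1 1 : ℤ) : ZMod N) = ((g 0 0 * g 1 1 - lam' * g 0 1 * g 1 0 : ℤ) : ZMod N) := by
    show (((γ * g⁻¹).1 1 1 : ℤ) : ZMod N) = _
    rw [η11]
    push_cast
    rw [k10, k11]
    ring
  rw [e11] at hη
  set X := χ ((g 0 0 * g 1 1 - lam' * g 0 1 * g 1 0 : ℤ) : ZMod N) with hX
  have hfγ : ⇑f ∣[k] γ = (fun _ => X) * (⇑f ∣[k] g) := by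
    have h1 : γ = (γ * g⁻¹) * g := by simp
    rw [h1, SlashAction.slash_mul, hη]
    funext τ
    simp only [ModularForm.SL_slash_apply, Pi.mul_apply, Pi.smul_apply, smul_eq_mul]
    ring
  have hfin := S8.HE.unique (M := 4 * N) (by omega) hmain (hfγ ▸ (S8.HE.const (4 * N) X).mul hp2)
  intro n
  have h1 := congr_arg (PowerSeries.coeff (4 * n)) hfin
  rw [PowerSeries.coeff_map, S8.coeff_stretch (by norm_num), PowerSeries.coeff_C_mul,
    S8.coeff_stretch (by norm_num), PowerSeries.coeff_mk] at h1
  exact h1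
end
end
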